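/- arXiv:2401.06943 — 11 statements merged into one kernel-verified Lean document; each statement's English description precedes it below -/
import Mathlib

section
/- Let (s, x₁, x₂) : [0, ∞) → ℝ³ be a C¹ solution of the random chemostat model with wall growth with nonnegative initial data s(0) ≥ 0, x₁(0) ≥ 0, x₂(0) ≥ 0. Then s(t) ≥ 0, x₁(t) ≥ 0 and x₂(t) ≥ 0 for all t ≥ 0; that is, the positive cone 𝒳 = {(s,x₁,x₂) : s ≥ 0, x₁ ≥ 0, x₂ ≥ 0} is positively invariant for the system. -/
open Real

lemma hasDerivAt_neg_part_sq (x : ℝ) :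
    HasDerivAt (fun y : ℝ => (min y 0) ^ 2) (2 * min x 0) x := by
  rcases lt_trichotomy x 0 with h | h | h
  · have h1 : HasDerivAt (fun y : ℝ => y ^ 2) (2 * min x 0) x := by
      have := hasDerivAt_pow 2 x
      rw [min_eq_left h.le]
      simpa using this
    refine h1.congr_of_eventuallyEq ?_
    filter_upwards [gt_mem_nhds h] with y hy
    rw [min_eq_left (le_of_lt hy)]
  · subst h
    rw [hasDerivAt_iff_isLittleO]
    have h2 : (fun y : ℝ => y ^ 2) =o[nhds 0] (fun y : ℝ => y) := by
      simpa using Asymptotics.isLittleO_pow_pow (𝕜 := ℝ) (m := 1) (n := 2) (by norm_num)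
    simp only [min_self, mul_zero, smul_zero, sub_zero, ne_eq, OfNat.ofNat_ne_zero,
      not_false_eq_true, zero_pow]
    refine Asymptotics.IsBigO.trans_isLittleO (Asymptotics.IsBigO.of_bound 1 ?_) h2
    filter_upwards with y
    rw [one_mul, Real.norm_of_nonneg (sq_nonneg _), Real.norm_of_nonneg (sq_nonneg _)]
    rcases le_total y 0 with h | h
    · rw [min_eq_left h]
    · rw [min_eq_right h]; nlinarith [sq_nonneg y]
  · have h1 : HasDerivAt (fun _ : ℝ => (0 : ℝ)) (2 * min x 0) x := by
      rw [min_eq_right h.le]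
      simpa using hasDerivAt_const x (0 : ℝ)
    refine h1.congr_of_eventuallyEq ?_
    filter_upwards [lt_mem_nhds h] with y hy
    rw [min_eq_right (le_of_lt hy)]
    simp

lemma coop_nonneg (A B x₁ x₂ : ℝ → ℝ) (c r₁ r₂ T : ℝ) (hT : 0 ≤ T)
    (hr₁ : 0 < r₁) (hr₂ : 0 < r₂)
    (hA : ∀ t ∈ Set.Icc 0 T, A t ≤ c) (hB : ∀ t ∈ Set.Icc 0 T, B t ≤ c)
    (h1 : ∀ t ∈ Set.Icc 0 T, HasDerivAt x₁ (A t * x₁ t + r₂ * x₂ t) t)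
    (h2 : ∀ t ∈ Set.Icc 0 T, HasDerivAt x₂ (B t * x₂ t + r₁ * x₁ t) t)
    (h10 : 0 ≤ x₁ 0) (h20 : 0 ≤ x₂ 0) : 0 ≤ x₁ T ∧ 0 ≤ x₂ T := by
  set K := 2 * c + r₁ + r₂ with hK
  set W : ℝ → ℝ := fun t => ((min (x₁ t) 0) ^ 2 + (min (x₂ t) 0) ^ 2) * exp (-K * t) with hW
  have hd : ∀ t ∈ Set.Icc 0 T, HasDerivAt W
      ((2 * min (x₁ t) 0 * (A t * x₁ t + r₂ * x₂ t)
        + 2 * min (x₂ t) 0 * (B t * x₂ t + r₁ * x₁ t)) * exp (-K * t)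
        + ((min (x₁ t) 0) ^ 2 + (min (x₂ t) 0) ^ 2) * (exp (-K * t) * (-K * 1))) t := by
    intro t ht
    have e1 := (hasDerivAt_neg_part_sq (x₁ t)).comp t (h1 t ht)
    have e2 := (hasDerivAt_neg_part_sq (x₂ t)).comp t (h2 t ht)
    have e3 := ((hasDerivAt_id t).const_mul (-K)).exp
    exact (e1.add e2).mul e3
  have hanti : AntitoneOn W (Set.Icc 0 T) := by
    apply antitoneOn_of_deriv_nonpos (convex_Icc 0 T)
    · exact fun t ht => (hd t ht).continuousAt.continuousWithinAt
    · exact fun t ht => (hd t (interior_subset ht)).differentiableAt.differentiableWithinAt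
    · intro t ht
      have ht := interior_subset ht
      rw [(hd t ht).deriv]
      have key : (2 * min (x₁ t) 0 * (A t * x₁ t + r₂ * x₂ t)
        + 2 * min (x₂ t) 0 * (B t * x₂ t + r₁ * x₁ t))
        ≤ K * ((min (x₁ t) 0) ^ 2 + (min (x₂ t) 0) ^ 2) := by
        have a1 := hA t ht
        have a2 := hB t ht
        generalize x₁ t = p at *
        generalize x₂ t = q at *
        generalize A t = A at *
        generalize B t = B at *
        have p0 : min p 0 ≤ 0 := min_le_right _ _
        have q0 : min q 0 ≤ 0 := min_le_right _ _
        have p1 : min p 0 ≤ p := min_le_left _ _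
        have q1 : min q 0 ≤ q := min_le_left _ _
        have pp : min p 0 * p = min p 0 ^ 2 := by
          rcases min_choice p 0 with h | h <;> rw [h] <;> ring
        have qq : min q 0 * q = min q 0 ^ 2 := by
          rcases min_choice q 0 with h | h <;> rw [h] <;> ring
        generalize min p 0 = u at *
        generalize min q 0 = v at *
        have s1 : A * (u * p) ≤ c * u ^ 2 := by
          rw [pp]; exact mul_le_mul_of_nonneg_right a1 (sq_nonneg _)
        have s2 : B * (v * q) ≤ c * v ^ 2 := by
          rw [qq]; exact mul_le_mul_of_nonneg_right a2 (sq_nonneg _)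
        have s3 : u * q ≤ u * v := mul_le_mul_of_nonpos_left q1 p0
        have s4 : v * p ≤ v * u := mul_le_mul_of_nonpos_left p1 q0
        have s5 := mul_le_mul_of_nonneg_left s3 hr₂.le
        have s6 := mul_le_mul_of_nonneg_left s4 hr₁.le
        have s7 := mul_nonneg (add_pos hr₁ hr₂).le (sq_nonneg (u - v))
        rw [hK]
        nlinarith
      nlinarith [exp_pos (-K * t)]
  have hle := hanti (Set.left_mem_Icc.2 hT) (Set.right_mem_Icc.2 hT) hT
  have hz : W 0 = 0 := by simp [hW, min_eq_right h10, min_eq_right h20]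
  rw [hz] at hle
  have hV : (min (x₁ T) 0) ^ 2 + (min (x₂ T) 0) ^ 2 ≤ 0 :=
    nonpos_of_mul_nonpos_left hle (exp_pos _)
  have q1 : min (x₁ T) 0 = 0 := by nlinarith [sq_nonneg (min (x₁ T) 0), sq_nonneg (min (x₂ T) 0)]
  have q2 : min (x₂ T) 0 = 0 := by nlinarith [sq_nonneg (min (x₁ T) 0), sq_nonneg (min (x₂ T) 0)]
  exact ⟨min_eq_right_iff.1 q1, min_eq_right_iff.1 q2⟩

/-- Positive invariance of the cone 𝒳 for the random chemostat
model with wall growth. -/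
theorem chemostat_wall_growth_positive_invariance
    (s_in a m c b ν r₁ r₂ b₁ b₂ : ℝ)
    (hs_in : 0 < s_in) (ha : 0 < a) (hc : 0 < c) (hcm : c ≤ m)
    (hb : 0 < b) (hb1 : b ≤ 1) (hν : 0 < ν) (hr₁ : 0 < r₁) (hr₂ : 0 < r₂)
    (hb₁ : 0 < b₁) (hb₁₂ : b₁ ≤ b₂)
    (d : ℝ → ℝ) (hd_cont : Continuous d)
    (hd_bounds : ∀ t, b₁ ≤ d t ∧ d t ≤ b₂)
    (s x₁ x₂ : ℝ → ℝ)
    (hs : ∀ t ∈ Set.Ici (0:ℝ), HasDerivAt s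
      (d t * (s_in - s t) - (m * s t / (a + s t)) * x₁ t
        - (m * s t / (a + s t)) * x₂ t + b * ν * x₁ t) t)
    (hx₁ : ∀ t ∈ Set.Ici (0:ℝ), HasDerivAt x₁
      (-(ν + d t) * x₁ t + (c * s t / (a + s t)) * x₁ t - r₁ * x₁ t + r₂ * x₂ t) t)
    (hx₂ : ∀ t ∈ Set.Ici (0:ℝ), HasDerivAt x₂
      (-ν * x₂ t + (c * s t / (a + s t)) * x₂ t + r₁ * x₁ t - r₂ * x₂ t) t)
    (h0 : 0 ≤ s 0 ∧ 0 ≤ x₁ 0 ∧ 0 ≤ x₂ 0) :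
    ∀ t ∈ Set.Ici (0:ℝ), 0 ≤ s t ∧ 0 ≤ x₁ t ∧ 0 ≤ x₂ t := by
  have hx : ∀ T, 0 ≤ T → (∀ t ∈ Set.Icc 0 T, 0 ≤ s t) → 0 ≤ x₁ T ∧ 0 ≤ x₂ T := by
    intro T hT hsT
    have hfrac : ∀ t ∈ Set.Icc 0 T, c * s t / (a + s t) ≤ c := by
      intro t ht
      have h := hsT t ht
      rw [div_le_iff₀ (by linarith)]
      nlinarith
    refine coop_nonneg (fun t => -(ν + d t) + c * s t / (a + s t) - r₁)
      (fun t => -ν + c * s t / (a + s t) - r₂) x₁ x₂ c r₁ r₂ T hT hr₁ hr₂ ?_ ?_ ?_ ?_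
      h0.2.1 h0.2.2
    · intro t ht
      have := hfrac t ht
      have := (hd_bounds t).1
      linarith
    · intro t ht
      have := hfrac t ht
      linarith
    · intro t ht
      convert hx₁ t ht.1 using 1
      ring
    · intro t ht
      convert hx₂ t ht.1 using 1
      ring
  have hs_nonneg : ∀ t, 0 ≤ t → 0 ≤ s t := by
    by_contra hcon
    push Not at hcon
    obtain ⟨t₁, ht₁, hst₁⟩ := hcon
    set S : Set ℝ := {t | 0 ≤ t ∧ s t < 0} with hS
    have hne : S.Nonempty := ⟨t₁, ht₁, hst₁⟩
    have hbdd : BddBelow S := ⟨0, fun t ht => ht.1⟩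
    set τ := sInf S with hτ
    have hτ0 : 0 ≤ τ := le_csInf hne fun t ht => ht.1
    have hbefore : ∀ t, 0 ≤ t → t < τ → 0 ≤ s t := by
      intro t ht htτ
      by_contra h
      exact absurd (csInf_le hbdd (show t ∈ S from ⟨ht, not_le.1 h⟩)) (not_le.2 htτ)
    have hsτ : 0 ≤ s τ := by
      rcases hτ0.eq_or_lt with h | h
      · rw [← h]; exact h0.1
      · have hc' : Filter.Tendsto s (nhdsWithin τ (Set.Iio τ)) (nhds (s τ)) :=
          (hs τ hτ0).continuousAt.continuousWithinAt
        refine ge_of_tendsto hc' ?_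
        filter_upwards [Ioo_mem_nhdsLT h] with t ht
        exact hbefore t ht.1.le ht.2
    have hxτ := hx τ hτ0 (by
      intro t ht
      rcases ht.2.eq_or_lt with h | h
      · rw [h]; exact hsτ
      · exact hbefore t ht.1 h)
    have hev : ∀ᶠ t in nhdsWithin τ (Set.Ioi τ), 0 ≤ s t := by
      rcases hsτ.eq_or_lt with h | h
      · have hD := hs τ hτ0
        rw [← h] at hD
        have hpos : 0 < d τ * (s_in - 0) - m * 0 / (a + 0) * x₁ τ - m * 0 / (a + 0) * x₂ τ
            + b * ν * x₁ τ := by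
          have e1 : 0 < d τ * s_in := mul_pos (lt_of_lt_of_le hb₁ (hd_bounds τ).1) hs_in
          have e2 : 0 ≤ b * ν * x₁ τ := mul_nonneg (mul_pos hb hν).le hxτ.1
          simp only [mul_zero, zero_div, zero_mul, sub_zero]
          linarith
        have hsl := (hasDerivAt_iff_tendsto_slope.1 hD).mono_left
          (nhdsWithin_mono τ (fun y (hy : τ < y) => (ne_of_gt hy : y ≠ τ)))
        filter_upwards [hsl.eventually (lt_mem_nhds hpos), self_mem_nhdsWithin] with t ht ht'
        rw [slope_def_field, ← h, sub_zero] at ht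
        have ht'' : 0 < t - τ := sub_pos.2 ht'
        exact ((div_pos_iff_of_pos_right ht'').1 ht).le
      · exact ((hs τ hτ0).continuousAt.eventually (lt_mem_nhds h)).filter_mono
          nhdsWithin_le_nhds |>.mono fun t ht => le_of_lt ht
    obtain ⟨u, hu, hsub⟩ := mem_nhdsGT_iff_exists_Ioo_subset.1 hev
    have hge : u ≤ τ := by
      refine le_csInf hne fun t ht => ?_
      by_contra hlt
      have h1 : τ ≤ t := csInf_le hbdd ht
      rcases h1.eq_or_lt with h | h
      · rw [h] at hsτ; exact absurd ht.2 (not_lt.2 hsτ)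
      · exact absurd ht.2 (not_lt.2 (hsub ⟨h, not_le.1 hlt⟩))
    exact absurd hu (not_lt.2 hge)
  intro t ht
  exact ⟨hs_nonneg t ht, hx t ht fun u hu => hs_nonneg u hu.1⟩
end

section
/- Let r₁ > 0, r₂ > 0, 0 < b₁ ≤ b₂, and let d : ℝ → ℝ be continuous with b₁ ≤ d(t) ≤ b₂ for all t. Let ξ : [0, ∞) → ℝ be a C¹ solution of ξ' = −d(t) ξ(1−ξ) − r₁ ξ + r₂(1−ξ) with ξ(0) = ξ₀ ∈ (0,1). Then for all t ≥ 0, ξ(t) ≤ ξ₀ e^{−(b₁+r₁+r₂)t} + ((b₁+r₂)/(b₁+r₁+r₂)) (1 − e^{−(b₁+r₁+r₂)t}). -/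
open Real

/-- upper bound for the proportion ξ. -/
theorem chemostat_proportion_upper_bound
    (r₁ r₂ b₁ b₂ : ℝ) (hr₁ : 0 < r₁) (hr₂ : 0 < r₂)
    (hb₁ : 0 < b₁) (hb₁₂ : b₁ ≤ b₂)
    (d : ℝ → ℝ) (hd_cont : Continuous d)
    (hd_bounds : ∀ t, b₁ ≤ d t ∧ d t ≤ b₂)
    (ξ : ℝ → ℝ) (ξ₀ : ℝ) (hξ0 : ξ 0 = ξ₀) (hξ0' : ξ₀ ∈ Set.Ioo (0:ℝ) 1)
    (hξ : ∀ t ∈ Set.Ici (0:ℝ), HasDerivAt ξ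
      (-d t * (ξ t * (1 - ξ t)) - r₁ * ξ t + r₂ * (1 - ξ t)) t) :
    ∀ t ∈ Set.Ici (0:ℝ),
      ξ t ≤ ξ₀ * exp (-(b₁ + r₁ + r₂) * t)
        + (b₁ + r₂) / (b₁ + r₁ + r₂) * (1 - exp (-(b₁ + r₁ + r₂) * t)) := by
  -- At a contact point with the boundary curve `B`, we have `0 < B < 1`, so the slope of `ξ`
  -- is strictly below that of `B`.
  intro t ht
  have hK : 0 < b₁ + r₁ + r₂ := by positivity
  set K := b₁ + r₁ + r₂ with hKdef
  set c := (b₁ + r₂) / K with hc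
  have hcK : c * K = b₁ + r₂ := div_mul_cancel₀ _ hK.ne'
  have hc0 : 0 < c := by positivity
  have hc1 : c < 1 := by
    rw [hc, div_lt_one hK]; linarith
  have hB : ∀ x, HasDerivAt (fun x => ξ₀ * exp (-K * x) + c * (1 - exp (-K * x)))
      (ξ₀ * (exp (-K * x) * -K) + c * (-(exp (-K * x) * -K))) x := by
    intro x
    have h1 : HasDerivAt (fun x => exp (-K * x)) (exp (-K * x) * -K) x := by
      have h2 : HasDerivAt (fun x : ℝ => -K * x) (-K) x := by
        simpa using (hasDerivAt_id x).const_mul (-K)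
      exact h2.exp
    exact (h1.const_mul ξ₀).add ((h1.const_sub 1).const_mul c)
  refine image_le_of_deriv_right_lt_deriv_boundary (a := 0) (b := t)
    (fun x hx => (hξ x hx.1).continuousAt.continuousWithinAt)
    (fun x hx => (hξ x hx.1).hasDerivWithinAt) ?_ hB ?_ ⟨ht, le_refl t⟩
  · simp [hξ0]
  · intro x hx hxB
    have he0 : 0 < exp (-K * x) := exp_pos _
    have he1 : exp (-K * x) ≤ 1 := by
      rw [exp_le_one_iff]
      nlinarith [hx.1]
    have hd := (hd_bounds x).1
    set e := exp (-K * x)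
    have hpos : 0 < ξ x := by
      rw [hxB]
      have := mul_pos hξ0'.1 he0
      have := mul_nonneg hc0.le (sub_nonneg.2 he1)
      linarith
    have hlt : ξ x < 1 := by
      rw [hxB]
      have := mul_pos (sub_pos.2 hξ0'.2) he0
      have := mul_nonneg (sub_pos.2 hc1).le (sub_nonneg.2 he1)
      linarith
    have hB' : ξ₀ * (e * -K) + c * (-(e * -K)) = -K * ξ x + (b₁ + r₂) := by
      rw [hxB, ← hcK]; ring
    rw [hB', hKdef]
    have h1 := mul_pos hpos (sub_pos.2 hlt)
    have h2 := mul_pos (hb₁.trans_le hd) h1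
    have h3 := mul_pos hb₁ (sub_pos.2 hlt)
    linarith
end

section
/- Let r₁ > 0, r₂ > 0, 0 < b₁ ≤ b₂, and let d : ℝ → ℝ be continuous with b₁ ≤ d(t) ≤ b₂ for all t. Let ξ : [0, ∞) → ℝ be a C¹ solution of ξ' = −d(t) ξ(1−ξ) − r₁ ξ + r₂(1−ξ) with ξ(0) = ξ₀ ∈ (0,1). Then for all t ≥ 0, ξ(t) ≥ ξ₀ e^{−(b₂+r₁+r₂)t} + (r₂/(b₂+r₁+r₂)) (1 − e^{−(b₂+r₁+r₂)t}). -/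
open Real

/-- lower bound for the proportion ξ. -/
theorem chemostat_proportion_lower_bound
    (r₁ r₂ b₁ b₂ : ℝ) (hr₁ : 0 < r₁) (hr₂ : 0 < r₂)
    (hb₁ : 0 < b₁) (hb₁₂ : b₁ ≤ b₂)
    (d : ℝ → ℝ) (hd_cont : Continuous d)
    (hd_bounds : ∀ t, b₁ ≤ d t ∧ d t ≤ b₂)
    (ξ : ℝ → ℝ) (ξ₀ : ℝ) (hξ0 : ξ 0 = ξ₀) (hξ0' : ξ₀ ∈ Set.Ioo (0:ℝ) 1)
    (hξ : ∀ t ∈ Set.Ici (0:ℝ), HasDerivAt ξ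
      (-d t * (ξ t * (1 - ξ t)) - r₁ * ξ t + r₂ * (1 - ξ t)) t) :
    ∀ t ∈ Set.Ici (0:ℝ),
      ξ₀ * exp (-(b₂ + r₁ + r₂) * t)
        + r₂ / (b₂ + r₁ + r₂) * (1 - exp (-(b₂ + r₁ + r₂) * t)) ≤ ξ t := by
  have hnn : ∀ t, 0 ≤ t → 0 ≤ ξ t := by
    intro T hT
    have h := image_le_of_deriv_right_lt_deriv_boundary (f := fun t => -ξ t)
      (f' := fun t => -(-d t * (ξ t * (1 - ξ t)) - r₁ * ξ t + r₂ * (1 - ξ t)))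
      (a := 0) (b := T) (B := fun _ => 0) (B' := fun _ => 0)
      (fun t ht => (hξ t ht.1).continuousAt.neg.continuousWithinAt)
      (fun t ht => (hξ t ht.1).neg.hasDerivWithinAt)
      (by simp only [hξ0]; linarith [hξ0'.1])
      (fun t => hasDerivAt_const t 0)
      (by
        intro t _ h0
        have h1 : ξ t = 0 := by simpa using h0
        simp [h1, hr₂])
      (Set.right_mem_Icc.2 hT)
    simpa using h
  intro T hT
  have hT0 : (0:ℝ) ≤ T := hT
  obtain ⟨c, hc⟩ : ∃ c, c = b₂ + r₁ + r₂ := ⟨_, rfl⟩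
  have hc0 : 0 < c := by rw [hc]; linarith
  rw [← hc]
  have hg : ∀ t, 0 ≤ t → HasDerivAt (fun t => (ξ t - r₂ / c) * exp (c * t))
      ((-d t * (ξ t * (1 - ξ t)) - r₁ * ξ t + r₂ * (1 - ξ t)) * exp (c * t)
        + (ξ t - r₂ / c) * (exp (c * t) * (c * 1))) t := fun t ht =>
    ((hξ t ht).sub_const _).mul (((hasDerivAt_id t).const_mul c).exp)
  have hmono : MonotoneOn (fun t => (ξ t - r₂ / c) * exp (c * t)) (Set.Ici 0) := by
    apply monotoneOn_of_deriv_nonneg (convex_Ici 0)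
    · exact fun t ht => (hg t ht).continuousAt.continuousWithinAt
    · exact fun t ht => (hg t (interior_subset ht)).differentiableAt.differentiableWithinAt
    · intro t ht
      have ht0 : 0 ≤ t := interior_subset ht
      rw [(hg t ht0).deriv]
      have e : (-d t * (ξ t * (1 - ξ t)) - r₁ * ξ t + r₂ * (1 - ξ t)) * exp (c * t)
        + (ξ t - r₂ / c) * (exp (c * t) * (c * 1))
        = ((b₂ - d t) * ξ t + d t * (ξ t * ξ t)) * exp (c * t) := by
        have : r₂ / c * c = r₂ := by field_simp
        linear_combination (-exp (c * t)) * this + ξ t * exp (c * t) * hc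
      rw [e]
      have h1 := hnn t ht0
      have h2 : 0 ≤ b₂ - d t := by linarith [(hd_bounds t).2]
      have h3 : 0 ≤ d t := by linarith [(hd_bounds t).1]
      positivity
  have h := hmono (Set.mem_Ici.2 le_rfl) hT hT0
  simp only [mul_zero, exp_zero, mul_one, hξ0] at h
  have h2 := mul_le_mul_of_nonneg_right h (exp_pos (-c * T)).le
  have h3 : exp (c * T) * exp (-c * T) = 1 := by
    rw [← exp_add]; simp
  rw [mul_assoc, h3] at h2
  linarith
end

section
/- Let r₁ > 0, r₂ > 0, 0 < b₁ ≤ b₂, and let d : ℝ → ℝ be continuous with b₁ ≤ d(t) ≤ b₂ for all t. Let ξ : [0, ∞) → ℝ be a C¹ solution of ξ' = −d(t) ξ(1−ξ) − r₁ ξ + r₂(1−ξ) with ξ(0) ∈ (0,1). Then ξ*_l ≤ liminf_{t→∞} ξ(t) and limsup_{t→∞} ξ(t) ≤ ξ*_u, where ξ*_l = r₂/(b₂+r₁+r₂) and ξ*_u = (b₁+r₂)/(b₁+r₁+r₂); consequently, for every ε > 0 there is T ≥ 0 with ξ*_l − ε ≤ ξ(t) ≤ ξ*_u + ε for all t ≥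 T, so the deterministic interval [ξ*_l, ξ*_u] is an attracting set (forwards in time) for the dynamics of the proportion. -/
open Real Filter

lemma aux_decay (f f' : ℝ → ℝ) (k c : ℝ) (hk : 0 < k)
    (hf : ∀ t ∈ Set.Ici (0:ℝ), HasDerivAt f (f' t) t)
    (hle : ∀ t ∈ Set.Ici (0:ℝ), f' t ≤ k * (c - f t)) :
    ∀ ε > 0, ∃ T ≥ (0:ℝ), ∀ t ≥ T, f t ≤ c + ε := by
  intro ε hε
  have hg : ∀ t ∈ Set.Ici (0:ℝ), HasDerivAt (fun t => (f t - c) * Real.exp (k * t))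
      (f' t * Real.exp (k * t) + (f t - c) * (Real.exp (k * t) * (k * 1))) t := by
    intro t ht
    exact ((hf t ht).sub_const c).mul (((hasDerivAt_id t).const_mul k).exp)
  have hanti : AntitoneOn (fun t => (f t - c) * Real.exp (k * t)) (Set.Ici 0) := by
    apply antitoneOn_of_deriv_nonpos (convex_Ici 0)
    · exact fun t ht => (hg t ht).continuousAt.continuousWithinAt
    · intro t ht
      exact (hg t (interior_subset ht)).differentiableAt.differentiableWithinAt
    · intro t ht
      rw [(hg t (interior_subset ht)).deriv]
      have h1 := hle t (interior_subset ht)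
      nlinarith [Real.exp_pos (k * t)]
  have hlim : Tendsto (fun t => Real.exp (k * t)) atTop atTop :=
    Real.tendsto_exp_atTop.comp (tendsto_id.const_mul_atTop hk)
  obtain ⟨T, hT⟩ := eventually_atTop.1 (hlim.eventually_ge_atTop ((f 0 - c) / ε))
  refine ⟨max T 0, le_max_right _ _, fun t ht => ?_⟩
  have ht0 : 0 ≤ t := le_trans (le_max_right _ _) ht
  have h1 := hT t (le_trans (le_max_left _ _) ht)
  have h2 : (f t - c) * Real.exp (k * t) ≤ (f 0 - c) * Real.exp (k * 0) :=
    hanti (Set.mem_Ici.2 le_rfl) ht0 ht0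
  rw [div_le_iff₀ hε] at h1
  simp only [mul_zero, Real.exp_zero, mul_one] at h2
  have h3 : (f t - c) * Real.exp (k * t) ≤ ε * Real.exp (k * t) := by linarith
  have := le_of_mul_le_mul_right h3 (Real.exp_pos _)
  linarith

lemma aux_barrier (f f' : ℝ → ℝ) (B : ℝ) (h0 : f 0 ≤ B)
    (hf : ∀ t ∈ Set.Ici (0:ℝ), HasDerivAt f (f' t) t)
    (hlt : ∀ t ∈ Set.Ici (0:ℝ), f t = B → f' t < 0) :
    ∀ t ∈ Set.Ici (0:ℝ), f t ≤ B := by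
  intro t ht
  exact image_le_of_deriv_right_lt_deriv_boundary (f := f) (f' := f') (a := 0) (b := t)
    (B := fun _ => B) (B' := fun _ => 0)
    (fun s hs => (hf s hs.1).continuousAt.continuousWithinAt)
    (fun s hs => (hf s hs.1).hasDerivWithinAt) h0 (fun s => hasDerivAt_const s B)
    (fun s hs h => hlt s hs.1 h) ⟨ht, le_rfl⟩


/-- the deterministic interval [ξ*_l, ξ*_u] attracts the
dynamics of the proportion ξ forwards in time. -/
theorem chemostat_proportion_attracting_interval
    (r₁ r₂ b₁ b₂ : ℝ) (hr₁ : 0 < r₁) (hr₂ : 0 < r₂)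
    (hb₁ : 0 < b₁) (hb₁₂ : b₁ ≤ b₂)
    (d : ℝ → ℝ) (hd_cont : Continuous d)
    (hd_bounds : ∀ t, b₁ ≤ d t ∧ d t ≤ b₂)
    (ξ : ℝ → ℝ) (h0 : ξ 0 ∈ Set.Ioo (0:ℝ) 1)
    (hξ : ∀ t ∈ Set.Ici (0:ℝ), HasDerivAt ξ
      (-d t * (ξ t * (1 - ξ t)) - r₁ * ξ t + r₂ * (1 - ξ t)) t)
    (ξl ξu : ℝ) (hξl : ξl = r₂ / (b₂ + r₁ + r₂))
    (hξu : ξu = (b₁ + r₂) / (b₁ + r₁ + r₂)) :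
    (ξl ≤ liminf ξ atTop ∧ limsup ξ atTop ≤ ξu) ∧
    ∀ ε > 0, ∃ T ≥ (0:ℝ), ∀ t ≥ T, ξl - ε ≤ ξ t ∧ ξ t ≤ ξu + ε := by
  have hle1 : ∀ t ∈ Set.Ici (0:ℝ), ξ t ≤ 1 := by
    refine aux_barrier ξ _ 1 h0.2.le hξ ?_
    intro t _ h
    simp only [h]
    linarith
  have hge0 : ∀ t ∈ Set.Ici (0:ℝ), -ξ t ≤ 0 := by
    refine aux_barrier (fun t => -ξ t) _ 0 (by simpa using h0.1.le) (fun t ht => (hξ t ht).neg) ?_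
    intro t _ h
    have h' : ξ t = 0 := by simpa using h
    simp only [h']
    linarith
  have hkl : 0 < b₂ + r₁ + r₂ := by linarith
  have hku : 0 < b₁ + r₁ + r₂ := by linarith
  have hl : (b₂ + r₁ + r₂) * ξl = r₂ := by rw [hξl]; field_simp
  have hu : (b₁ + r₁ + r₂) * ξu = b₁ + r₂ := by rw [hξu]; field_simp
  have hU := aux_decay ξ _ (b₁ + r₁ + r₂) ξu hku hξ (by
    intro t ht
    have h1 := hle1 t ht
    have h2 := hge0 t ht
    have h3 : 0 ≤ ξ t * (1 - ξ t) := mul_nonneg (by linarith) (by linarith)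
    have h4 := mul_nonneg (sub_nonneg.2 (hd_bounds t).1) h3
    have h5 := mul_nonneg hb₁.le h3
    have h6 := mul_nonneg hb₁.le (sub_nonneg.2 h1)
    nlinarith)
  have hL := aux_decay (fun t => -ξ t) _ (b₂ + r₁ + r₂) (-ξl) hkl
    (fun t ht => (hξ t ht).neg) (by
    intro t ht
    have h1 := hle1 t ht
    have h2 := hge0 t ht
    have h3 : 0 ≤ ξ t * (1 - ξ t) := mul_nonneg (by linarith) (by linarith)
    have h4 := mul_nonneg (sub_nonneg.2 (hd_bounds t).2) h3
    have h5 := mul_nonneg (hb₁.le.trans hb₁₂) (mul_self_nonneg (ξ t))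
    nlinarith)
  have hmain : ∀ ε > 0, ∃ T ≥ (0:ℝ), ∀ t ≥ T, ξl - ε ≤ ξ t ∧ ξ t ≤ ξu + ε := by
    intro ε hε
    obtain ⟨T₁, hT₁, h₁⟩ := hU ε hε
    obtain ⟨T₂, hT₂, h₂⟩ := hL ε hε
    refine ⟨max T₁ T₂, le_trans hT₁ (le_max_left _ _), fun t ht => ?_⟩
    have a := h₁ t (le_trans (le_max_left _ _) ht)
    have b := h₂ t (le_trans (le_max_right _ _) ht)
    exact ⟨by linarith, a⟩
  have hbA : IsBoundedUnder (· ≤ ·) atTop ξ :=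
    isBoundedUnder_of_eventually_le (a := 1) ((eventually_ge_atTop 0).mono hle1)
  have hbB : IsBoundedUnder (· ≥ ·) atTop ξ :=
    isBoundedUnder_of_eventually_ge (a := 0)
      ((eventually_ge_atTop 0).mono fun t ht => by linarith [hge0 t ht])
  refine ⟨⟨?_, ?_⟩, hmain⟩
  · refine le_of_forall_pos_le_add fun ε hε => ?_
    obtain ⟨T, _, h⟩ := hmain ε hε
    have : ξl - ε ≤ liminf ξ atTop :=
      le_liminf_of_le hbA.isCoboundedUnder_ge ((eventually_ge_atTop T).mono fun t ht => (h t ht).1)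
    linarith
  · refine le_of_forall_pos_le_add fun ε hε => ?_
    obtain ⟨T, _, h⟩ := hmain ε hε
    exact limsup_le_of_le hbB.isCoboundedUnder_le
      ((eventually_ge_atTop T).mono fun t ht => (h t ht).2)
end

section
/- Let s_in > 0, 0 < c ≤ m, 0 < b ≤ 1, ν > 0, 0 < b₁ ≤ b₂, let ξ*_l ∈ (0,1], and let d : ℝ → ℝ be continuous with b₁ ≤ d(t) ≤ b₂ for all t. Set μ = b₂ + ν − (c b ν/m) ξ*_l, and note μ > 0. Let z : [0, ∞) → ℝ be C¹ with z(0) = z₀ ≥ 0 and suppose z'(t) ≥ −(ν + d(t) − (c b ν/m) ξ*_l) z(t) + c s_in d(t) for all t ≥ 0. Then for all t ≥ 0, z(t) ≥ z₀ e^{−μ t} + (c s_in b₁/μ) (1 − e^{−μ t}). -/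
open Real

/-- lower comparison estimate for the weighted total
concentration `z = c s + m x`. -/
theorem chemostat_z_lower_bound
    (s_in m c b ν b₁ b₂ ξl : ℝ) (hs_in : 0 < s_in)
    (hc : 0 < c) (hcm : c ≤ m) (hb : 0 < b) (hb1 : b ≤ 1) (hν : 0 < ν)
    (hb₁ : 0 < b₁) (hb₁₂ : b₁ ≤ b₂)
    (hξl : ξl ∈ Set.Ioc (0:ℝ) 1)
    (d : ℝ → ℝ) (hd_cont : Continuous d)
    (hd_bounds : ∀ t, b₁ ≤ d t ∧ d t ≤ b₂)
    (μ : ℝ) (hμ : μ = b₂ + ν - (c * b * ν / m) * ξl)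
    (z : ℝ → ℝ) (z₀ : ℝ) (hz0 : z 0 = z₀) (hz0' : 0 ≤ z₀)
    (z' : ℝ → ℝ)
    (hz : ∀ t ∈ Set.Ici (0:ℝ), HasDerivAt z (z' t) t)
    (hineq : ∀ t ∈ Set.Ici (0:ℝ),
      -(ν + d t - (c * b * ν / m) * ξl) * z t + c * s_in * d t ≤ z' t) :
    0 < μ ∧
    ∀ t ∈ Set.Ici (0:ℝ),
      z₀ * exp (-μ * t) + c * s_in * b₁ / μ * (1 - exp (-μ * t)) ≤ z t := by
  have hm : 0 < m := lt_of_lt_of_le hc hcm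
  obtain ⟨hξ0, hξ1⟩ := hξl
  have hk : c * b * ν / m * ξl ≤ ν := by
    have h1 : c * b * ν / m ≤ ν := by
      rw [div_le_iff₀ hm]
      have : c * b ≤ m := by nlinarith
      nlinarith
    have h0 : 0 ≤ c * b * ν / m := by positivity
    nlinarith
  generalize c * b * ν / m * ξl = k at *
  have hμ0 : 0 < μ := by linarith
  refine ⟨hμ0, ?_⟩
  have hpos : ∀ t, 0 ≤ t → 0 ≤ z t := by
    intro t ht
    have h := image_le_of_deriv_right_lt_deriv_boundary (f := fun x => - z x)
      (f' := fun x => - z' x) (a := 0) (b := t) (B := fun _ => (0:ℝ)) (B' := fun _ => (0:ℝ))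
      (fun x hx => (hz x hx.1).continuousAt.neg.continuousWithinAt)
      (fun x hx => (hz x hx.1).neg.hasDerivWithinAt)
      (by simp only [hz0]; linarith) (fun x => hasDerivAt_const x 0)
      (by
        intro x hx h0
        have hzx : z x = 0 := by simpa using h0
        have h1 := hineq x hx.1
        rw [hzx] at h1
        have h2 : 0 < c * s_in * d x :=
          mul_pos (mul_pos hc hs_in) (lt_of_lt_of_le hb₁ (hd_bounds x).1)
        show - z' x < 0
        linarith) (Set.right_mem_Icc.2 ht)
    linarith
  intro t ht
  set K := c * s_in * b₁ / μ with hK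
  have hKμ : μ * K = c * s_in * b₁ := by rw [hK]; field_simp
  have hG : ∀ x ∈ Set.Ici (0:ℝ), HasDerivAt (fun x => exp (μ * x) * (z x - K))
      (exp (μ * x) * μ * (z x - K) + exp (μ * x) * z' x) x := by
    intro x hx
    have h1 : HasDerivAt (fun x => exp (μ * x)) (exp (μ * x) * μ) x := by
      simpa using ((hasDerivAt_id x).const_mul μ).exp
    exact h1.mul ((hz x hx).sub_const K)
  have hmono : MonotoneOn (fun x => exp (μ * x) * (z x - K)) (Set.Ici 0) := by
    apply monotoneOn_of_deriv_nonneg (convex_Ici 0)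
    · exact fun x hx => (hG x hx).continuousAt.continuousWithinAt
    · exact fun x hx => (hG x (interior_subset hx)).differentiableAt.differentiableWithinAt
    · intro x hx
      have hx' := interior_subset hx
      rw [(hG x hx').deriv]
      have h1 := hineq x hx'
      have h2 := mul_nonneg (sub_nonneg.2 (hd_bounds x).2) (hpos x hx')
      have h3 := mul_nonneg (mul_pos hc hs_in).le (sub_nonneg.2 (hd_bounds x).1)
      have h4 : 0 ≤ μ * (z x - K) + z' x := by
        rw [mul_sub, hKμ, hμ]; nlinarith
      have := mul_nonneg (exp_pos (μ * x)).le h4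
      linarith
  have h := hmono (Set.self_mem_Ici) ht ht
  simp only [mul_zero, exp_zero, one_mul, hz0] at h
  have he : exp (-μ * t) * exp (μ * t) = 1 := by rw [← exp_add]; simp
  have h5 := mul_le_mul_of_nonneg_left h (exp_pos (-μ * t)).le
  rw [← mul_assoc, he] at h5
  linarith
end

section
/- Let (s, x, ξ) : [0, ∞) → ℝ³ be a C¹ solution of the transformed random chemostat system with s(0) > 0, x(0) > 0 and ξ(0) ∈ (0,1). Then the weighted total concentration z(t) = c s(t) + m x(t) satisfies z*_l ≤ liminf_{t→∞} z(t) and limsup_{t→∞} z(t) ≤ z*_u. Consequently, for every ε > 0 there is T ≥ 0 such that z*_l − ε ≤ c s(t) + m x(t) ≤ z*_u + ε for all t ≥ T, so B₀^{(s,x)} = {(s,x) ∈ ℝ²₊ : z*_l ≤ c s + m x ≤ z*_u} is a deterministic attracting set (forwards in time) for the (s,x) dynamics. -/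
open Real Filter

lemma aux_first_exit (f : ℝ → ℝ) (hf : ContinuousOn f (Set.Ici 0)) (h0 : 0 < f 0)
    (t : ℝ) (ht : 0 ≤ t) (hft : f t ≤ 0) :
    ∃ τ, 0 < τ ∧ f τ = 0 ∧ ∀ u, 0 ≤ u → u < τ → 0 < f u := by
  set S : Set ℝ := Set.Ici 0 ∩ f ⁻¹' Set.Iic 0 with hS
  have hcl : IsClosed S := hf.preimage_isClosed_of_isClosed isClosed_Ici isClosed_Iic
  have hne : S.Nonempty := ⟨t, ht, hft⟩
  have hbd : BddBelow S := ⟨0, fun u hu => hu.1⟩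
  have hmem : sInf S ∈ S := hcl.csInf_mem hne hbd
  have hbefore : ∀ u, 0 ≤ u → u < sInf S → 0 < f u := by
    intro u hu hlt
    by_contra hcon
    exact absurd (csInf_le hbd (show u ∈ S from ⟨hu, not_lt.mp hcon⟩)) (not_le.mpr hlt)
  have h0le : (0:ℝ) ≤ sInf S := hmem.1
  have hle : f (sInf S) ≤ 0 := hmem.2
  have hpos : 0 < sInf S := by
    rcases h0le.lt_or_eq with h | h
    · exact h
    · rw [← h] at hle; linarith
  refine ⟨sInf S, hpos, ?_, hbefore⟩
  by_contra hne0
  have hlt : f (sInf S) < 0 := lt_of_le_of_ne hle hne0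
  have hsub : Set.Icc 0 (sInf S) ⊆ Set.Ici (0:ℝ) := fun u hu => hu.1
  obtain ⟨u, hu, hfu⟩ := intermediate_value_Icc' h0le (hf.mono hsub)
    (show (0:ℝ) ∈ Set.Icc (f (sInf S)) (f 0) from ⟨hle, h0.le⟩)
  have hult : u < sInf S := by
    rcases hu.2.lt_or_eq with h | h
    · exact h
    · rw [h] at hfu; linarith
  have := hbefore u hu.1 hult
  linarith

lemma aux_deriv_nonpos (f : ℝ → ℝ) (f' τ : ℝ) (hτ : 0 < τ) (hd : HasDerivAt f f' τ)
    (h0 : f τ = 0) (hb : ∀ u, 0 ≤ u → u < τ → 0 < f u) : f' ≤ 0 := by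
  have h1 : Tendsto (slope f τ) (nhdsWithin τ (Set.Iio τ)) (nhds f') :=
    (hasDerivAt_iff_tendsto_slope.mp hd).mono_left
      (nhdsWithin_mono _ (fun u hu => ne_of_lt hu))
  refine le_of_tendsto h1 ?_
  have : Set.Ioo 0 τ ∈ nhdsWithin τ (Set.Iio τ) := Ioo_mem_nhdsLT hτ
  filter_upwards [this] with u hu
  rw [slope_def_field, h0]
  have := hb u hu.1.le hu.2
  exact div_nonpos_of_nonneg_of_nonpos (by linarith) (by linarith [hu.2])

lemma aux_pos (f g : ℝ → ℝ) (hd : ∀ t ∈ Set.Ici (0:ℝ), HasDerivAt f (g t) t) (h0 : 0 < f 0)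
    (hg : ∀ t, 0 ≤ t → f t = 0 → 0 < g t) : ∀ t, 0 ≤ t → 0 < f t := by
  intro t ht
  by_contra hcon
  obtain ⟨τ, hτ, hfτ, hb⟩ := aux_first_exit f
    (fun u hu => (hd u hu).continuousAt.continuousWithinAt) h0 t ht (not_lt.mp hcon)
  have := aux_deriv_nonpos f (g τ) τ hτ (hd τ hτ.le) hfτ hb
  have := hg τ hτ.le hfτ
  linarith

/-- exponential comparison on an interval -/
lemma aux_exp (f g : ℝ → ℝ) (A K T t : ℝ) (hK : 0 < K) (hTt : T ≤ t)
    (hc : ∀ u ∈ Set.Icc T t, HasDerivAt f (g u) u)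
    (hg : ∀ u ∈ Set.Ioo T t, A - K * f u ≤ g u) :
    A / K + (f T - A / K) * exp (-(K * (t - T))) ≤ f t := by
  have hD : ∀ u ∈ Set.Icc T t, HasDerivAt (fun u => (f u - A / K) * exp (K * u))
      (g u * exp (K * u) + (f u - A / K) * (exp (K * u) * K)) u := by
    intro u hu
    have h1 : HasDerivAt (fun u => exp (K * u)) (exp (K * u) * K) u := by
      simpa using ((hasDerivAt_id u).const_mul K).exp
    exact ((hc u hu).sub_const (A / K)).mul h1
  have hmono : MonotoneOn (fun u => (f u - A / K) * exp (K * u)) (Set.Icc T t) := by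
    apply monotoneOn_of_deriv_nonneg (convex_Icc T t)
    · exact fun u hu => (hD u hu).continuousAt.continuousWithinAt
    · intro u hu
      rw [interior_Icc] at hu
      exact (hD u ⟨hu.1.le, hu.2.le⟩).differentiableAt.differentiableWithinAt
    · intro u hu
      rw [interior_Icc] at hu
      rw [(hD u ⟨hu.1.le, hu.2.le⟩).deriv]
      have h2 := hg u hu
      have h3 : g u * exp (K * u) + (f u - A / K) * (exp (K * u) * K)
          = (g u - (A - K * f u)) * exp (K * u) := by
        field_simp
        ring
      rw [h3]
      exact mul_nonneg (by linarith) (exp_pos _).le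
  have h := hmono (Set.left_mem_Icc.mpr hTt) (Set.right_mem_Icc.mpr hTt) hTt
  simp only at h
  have h4 : exp (-(K * (t - T))) * exp (K * t) = exp (K * T) := by
    rw [← exp_add]; congr 1; ring
  have hp := exp_pos (K * t)
  rw [← h4, ← mul_assoc] at h
  have := le_of_mul_le_mul_right h hp
  linarith

lemma aux_asymp (f g : ℝ → ℝ) (A K T : ℝ) (hK : 0 < K)
    (hc : ∀ u, T ≤ u → HasDerivAt f (g u) u)
    (hg : ∀ u, T ≤ u → A - K * f u ≤ g u) (L : ℝ) (hL : L < A / K) :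
    ∀ᶠ t in atTop, L ≤ f t := by
  have hlim : Tendsto (fun t => A / K + (f T - A / K) * exp (-(K * (t - T)))) atTop
      (nhds (A / K + (f T - A / K) * 0)) := by
    refine tendsto_const_nhds.add (tendsto_const_nhds.mul ?_)
    apply tendsto_exp_neg_atTop_nhds_zero.comp
    exact (tendsto_atTop_add_const_right atTop (-T) tendsto_id).const_mul_atTop hK
  have hev := hlim.eventually (lt_mem_nhds (show L < A / K + (f T - A / K) * 0 by simpa using hL))
  filter_upwards [hev, eventually_ge_atTop T] with t h1 h2
  have := aux_exp f g A K T t hK h2 (fun u hu => hc u hu.1) (fun u hu => hg u hu.1.le)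
  linarith

set_option maxHeartbeats 2000000 in
/-- the weighted total concentration `z = c s + m x` is
asymptotically confined to the deterministic interval `[z*_l, z*_u]`. -/
theorem chemostat_transformed_attracting_set
    (s_in a m c b ν r₁ r₂ b₁ b₂ : ℝ)
    (hs_in : 0 < s_in) (ha : 0 < a) (hc : 0 < c) (hcm : c ≤ m)
    (hb : 0 < b) (hb1 : b ≤ 1) (hν : 0 < ν) (hr₁ : 0 < r₁) (hr₂ : 0 < r₂)
    (hb₁ : 0 < b₁) (hb₁₂ : b₁ ≤ b₂)
    (d : ℝ → ℝ) (hd_cont : Continuous d)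
    (hd_bounds : ∀ t, b₁ ≤ d t ∧ d t ≤ b₂)
    (s x ξ : ℝ → ℝ)
    (h0 : 0 < s 0 ∧ 0 < x 0 ∧ ξ 0 ∈ Set.Ioo (0:ℝ) 1)
    (hs : ∀ t ∈ Set.Ici (0:ℝ), HasDerivAt s
      (d t * (s_in - s t) - (m * s t / (a + s t)) * x t + b * ν * (ξ t * x t)) t)
    (hx : ∀ t ∈ Set.Ici (0:ℝ), HasDerivAt x
      (-ν * x t - d t * (ξ t * x t) + (c * s t / (a + s t)) * x t) t)
    (hξ : ∀ t ∈ Set.Ici (0:ℝ), HasDerivAt ξ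
      (-d t * (ξ t * (1 - ξ t)) - r₁ * ξ t + r₂ * (1 - ξ t)) t)
    (ξl zl zu : ℝ) (hξl : ξl = r₂ / (b₂ + r₁ + r₂))
    (hzl : zl = c * s_in * b₁ / (b₂ + ν - (c * b * ν / m) * ξl))
    (hzu : zu = c * s_in * b₂ / (ξl * b₁))
    (z : ℝ → ℝ) (hz : ∀ t, z t = c * s t + m * x t) :
    (zl ≤ liminf z atTop ∧ limsup z atTop ≤ zu) ∧
    ∀ ε > 0, ∃ T ≥ (0:ℝ), ∀ t ≥ T,
      zl - ε ≤ c * s t + m * x t ∧ c * s t + m * x t ≤ zu + ε := by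
  obtain ⟨hs0, hx0, hξ0⟩ := h0
  have hm : 0 < m := lt_of_lt_of_le hc hcm
  have hb₂ : 0 < b₂ := lt_of_lt_of_le hb₁ hb₁₂
  have hξpos : ∀ t, 0 ≤ t → 0 < ξ t := by
    refine aux_pos ξ _ hξ hξ0.1 ?_
    intro t ht h
    rw [h]; linarith
  have hξlt : ∀ t, 0 ≤ t → 0 < 1 - ξ t := by
    refine aux_pos (fun t => 1 - ξ t) _ (fun t ht => (hξ t ht).const_sub 1)
      (by have := hξ0.2; linarith) ?_
    intro t ht h
    have : ξ t = 1 := by linarith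
    rw [this]; linarith
  have hsx : ∀ t, 0 ≤ t → 0 < s t ∧ 0 < x t := by
    intro t ht
    by_contra hcon
    have hle : min (s t) (x t) ≤ 0 := by
      by_contra h
      exact hcon (lt_min_iff.mp (not_le.mp h))
    have hsc : ContinuousOn s (Set.Ici 0) :=
      fun u hu => (hs u hu).continuousAt.continuousWithinAt
    have hxc : ContinuousOn x (Set.Ici 0) :=
      fun u hu => (hx u hu).continuousAt.continuousWithinAt
    obtain ⟨τ, hτ, hfτ, hbe⟩ := aux_first_exit (fun t => min (s t) (x t)) (hsc.inf hxc)
      (lt_min hs0 hx0) t ht hle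
    have hxτ : 0 < x τ := by
      have := aux_exp x _ 0 (ν + b₂) 0 τ (by linarith) hτ.le (fun u hu => hx u hu.1) (by
        intro u hu
        obtain ⟨h1, h2⟩ := lt_min_iff.mp (hbe u hu.1.le hu.2)
        have h3 : 0 ≤ (c * s u / (a + s u)) * x u := by positivity
        have h4 := hξpos u hu.1.le
        have h5 := hξlt u hu.1.le
        have h6 : d u * (ξ u * x u) ≤ b₂ * x u := by
          have h7 : ξ u * x u ≤ x u := by nlinarith
          have h8 : 0 ≤ ξ u * x u := by positivity
          have := (hd_bounds u).2
          nlinarith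
        linarith)
      refine lt_of_lt_of_le ?_ this
      simp only [zero_div, sub_zero, zero_add]
      positivity
    have hsτ : s τ = 0 := by
      rcases min_choice (s τ) (x τ) with h | h
      · rw [← h]; exact hfτ
      · rw [h] at hfτ; linarith
    have h1 := aux_deriv_nonpos s _ τ hτ (hs τ hτ.le) hsτ
      (fun u h1 h2 => (lt_min_iff.mp (hbe u h1 h2)).1)
    rw [hsτ] at h1
    have h2 : 0 < d τ * s_in := mul_pos (by linarith [(hd_bounds τ).1]) hs_in
    have h3 : 0 < b * ν * (ξ τ * x τ) := by
      have := hξpos τ hτ.le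
      positivity
    simp only [mul_zero, zero_div, zero_mul, sub_zero] at h1
    linarith
  have hQ : 0 < b₂ + r₁ + r₂ := by linarith
  have hξl0 : 0 < ξl := by rw [hξl]; positivity
  have hξl1 : ξl < 1 := by rw [hξl, div_lt_one hQ]; linarith
  have hξev : ∀ δ > 0, ∀ᶠ t in atTop, ξl - δ ≤ ξ t := by
    intro δ hδ
    refine aux_asymp ξ _ r₂ (b₂ + r₁ + r₂) 0 hQ (fun u hu => hξ u hu) ?_ _
      (by rw [← hξl]; linarith)
    intro u hu
    have h1 := hξpos u hu
    have h2 := hξlt u hu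
    have h3 : d u * (ξ u * (1 - ξ u)) ≤ b₂ * ξ u := by
      have h7 : ξ u * (1 - ξ u) ≤ ξ u := by nlinarith
      have h8 : 0 ≤ ξ u * (1 - ξ u) := by positivity
      have := (hd_bounds u).2
      nlinarith
    linarith
  have hzd : ∀ t, 0 ≤ t → HasDerivAt z
      (c * d t * s_in - d t * (c * s t) - m * x t * (ν - c * b * ν / m * ξ t + d t * ξ t)) t := by
    intro t ht
    have hzf : z = fun t => c * s t + m * x t := funext hz
    rw [hzf]
    refine HasDerivAt.congr_deriv (((hs t ht).const_mul c).add ((hx t ht).const_mul m)) ?_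
    have : a + s t ≠ 0 := by have := (hsx t ht).1; positivity
    field_simp
    ring
  set κ := c * b * ν / m with hκ
  have hκ0 : 0 < κ := by positivity
  have hκν : κ ≤ ν := by
    rw [hκ, div_le_iff₀ hm]
    have : c * b ≤ m := by nlinarith
    nlinarith
  have hlow : ∀ ε > 0, ∀ᶠ t in atTop, zl - ε ≤ z t := by
    intro ε hε
    have hden : 0 < b₂ + ν - κ * ξl := by nlinarith
    have hcont : Tendsto (fun δ => c * s_in * b₁ / (b₂ + ν - κ * (ξl - δ))) (nhdsWithin 0 (Set.Ioi 0))
        (nhds zl) := by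
      have : ContinuousAt (fun δ => c * s_in * b₁ / (b₂ + ν - κ * (ξl - δ))) 0 := by
        apply ContinuousAt.div (by fun_prop) (by fun_prop)
        simpa using hden.ne'
      have h := this.tendsto
      simp only [sub_zero] at h
      rw [← hzl] at h
      exact h.mono_left nhdsWithin_le_nhds
    obtain ⟨δ, hδ1, hδ⟩ := ((hcont.eventually (lt_mem_nhds (show zl - ε < zl by linarith))).and
      self_mem_nhdsWithin).exists
    have hδ : 0 < δ := hδ
    obtain ⟨T, hT⟩ := eventually_atTop.mp (hξev δ hδ)
    refine aux_asymp z _ (c * s_in * b₁) (b₂ + ν - κ * (ξl - δ)) (max T 0) (by nlinarith)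
      (fun u hu => hzd u (le_trans (le_max_right _ _) hu)) ?_ _ hδ1
    intro u hu
    have hu0 : 0 ≤ u := le_trans (le_max_right _ _) hu
    have h1 := hT u (le_trans (le_max_left _ _) hu)
    obtain ⟨h2, h3⟩ := hsx u hu0
    have h4 := hξpos u hu0
    have h5 := hξlt u hu0
    obtain ⟨h6, h7⟩ := hd_bounds u
    have e1 : c * s_in * b₁ ≤ c * s_in * d u := by gcongr
    have e2 : κ * (ξl - δ) ≤ ν := by nlinarith
    have e3 : d u * (c * s u) ≤ (b₂ + ν - κ * (ξl - δ)) * (c * s u) := by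
      apply mul_le_mul_of_nonneg_right (by linarith) (by positivity)
    have e4 : m * x u * (ν - κ * ξ u + d u * ξ u) ≤ m * x u * (b₂ + ν - κ * (ξl - δ)) := by
      apply mul_le_mul_of_nonneg_left _ (by positivity)
      have : κ * (ξl - δ) ≤ κ * ξ u := by gcongr
      nlinarith
    rw [hz u]
    linarith
  have hupp : ∀ ε > 0, ∀ᶠ t in atTop, z t ≤ zu + ε := by
    intro ε hε
    have hcont : Tendsto (fun δ => c * s_in * b₂ / ((ξl - δ) * b₁)) (nhdsWithin 0 (Set.Ioi 0))
        (nhds zu) := by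
      have : ContinuousAt (fun δ => c * s_in * b₂ / ((ξl - δ) * b₁)) 0 := by
        apply ContinuousAt.div (by fun_prop) (by fun_prop)
        simpa using ⟨hξl0.ne', hb₁.ne'⟩
      have h := this.tendsto
      simp only [sub_zero] at h
      rw [← hzu] at h
      exact h.mono_left nhdsWithin_le_nhds
    obtain ⟨δ, hδ1, hδ, hδ2⟩ := ((hcont.eventually (gt_mem_nhds (show zu < zu + ε by linarith))).and
      (Ioo_mem_nhdsGT hξl0)).exists
    obtain ⟨T, hT⟩ := eventually_atTop.mp (hξev δ hδ)
    have hK : 0 < (ξl - δ) * b₁ := mul_pos (by linarith) hb₁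
    have key := aux_asymp (fun t => - z t) _ (-(c * s_in * b₂)) ((ξl - δ) * b₁) (max T 0) hK
      (fun u hu => (hzd u (le_trans (le_max_right _ _) hu)).neg) (by
      intro u hu
      have hu0 : 0 ≤ u := le_trans (le_max_right _ _) hu
      have h1 := hT u (le_trans (le_max_left _ _) hu)
      obtain ⟨h2, h3⟩ := hsx u hu0
      have h4 := hξpos u hu0
      have h5 := hξlt u hu0
      obtain ⟨h6, h7⟩ := hd_bounds u
      have e1 : c * s_in * d u ≤ c * s_in * b₂ := by gcongr
      have e3 : (ξl - δ) * b₁ * (c * s u) ≤ d u * (c * s u) := by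
        apply mul_le_mul_of_nonneg_right _ (by positivity)
        have j1 : (ξl - δ) * b₁ ≤ 1 * b₁ := mul_le_mul_of_nonneg_right (by linarith) hb₁.le
        linarith
      have e4 : m * x u * ((ξl - δ) * b₁) ≤ m * x u * (ν - κ * ξ u + d u * ξ u) := by
        apply mul_le_mul_of_nonneg_left _ (by positivity)
        have i1 : κ * ξ u ≤ ν := by nlinarith
        have i2 : (ξl - δ) * b₁ ≤ ξ u * d u := by
          apply mul_le_mul h1 h6 hb₁.le h4.le
        linarith
      rw [hz u]
      linarith) (-(zu + ε)) (by rw [neg_div]; linarith)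
    filter_upwards [key] with t ht
    linarith
  have hB1 : IsBoundedUnder (· ≤ ·) atTop z := ⟨zu + 1, by simpa using hupp 1 one_pos⟩
  have hB2 : IsBoundedUnder (· ≥ ·) atTop z := ⟨zl - 1, by simpa using hlow 1 one_pos⟩
  refine ⟨⟨?_, ?_⟩, ?_⟩
  · refine le_of_forall_pos_le_add fun ε hε => ?_
    have := le_liminf_of_le hB1.isCoboundedUnder_ge (hlow ε hε)
    linarith
  · refine le_of_forall_pos_le_add fun ε hε => ?_
    exact limsup_le_of_le hB2.isCoboundedUnder_le (hupp ε hε)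
  · intro ε hε
    obtain ⟨T, hT⟩ := eventually_atTop.mp ((hlow ε hε).and (hupp ε hε))
    refine ⟨max T 0, le_max_right _ _, fun t ht => ?_⟩
    have := hT t (le_trans (le_max_left _ _) ht)
    rwa [hz t] at this
end

section
/- Assume the persistence condition ν + b₂ < z*_l/(a + z*_u/c) holds, and set x̃ = (z*_l − (ν + b₂)(a + z*_u/c))/(m + c), so that x̃ > 0. Let (s, x, ξ) : [0, ∞) → ℝ³ be a C¹ solution of the transformed random chemostat system with s(0) > 0, x(0) > 0 and ξ(0) ∈ (0,1). Then there exists T ≥ 0 such that x(t) > x̃ for all t ≥ T; in particular liminf_{t→∞} x(t) ≥ x̃ > 0, i.e. the total microbial biomass persists in the strong sense. -/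
open Real Filter

/-- Barrier lemma. -/
lemma chem_barrier (f f' : ℝ → ℝ) (T T₁ k : ℝ)
    (hf : ∀ t, T ≤ t → t ≤ T₁ → HasDerivAt f (f' t) t) (h0 : k < f T)
    (hb : ∀ t, T ≤ t → t ≤ T₁ → (∀ u, T ≤ u → u ≤ t → k ≤ f u) → f t = k → 0 < f' t) :
    ∀ t, T ≤ t → t ≤ T₁ → k < f t := by
  intro t ht ht1
  by_contra hcon
  have hcon : f t ≤ k := not_lt.mp hcon
  have hcont : ContinuousOn f (Set.Icc T T₁) := fun u hu =>
    (hf u hu.1 hu.2).continuousAt.continuousWithinAt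
  have hcl : IsClosed (Set.Icc T T₁ ∩ f ⁻¹' (Set.Iic k)) :=
    hcont.preimage_isClosed_of_isClosed isClosed_Icc isClosed_Iic
  have hcpt : IsCompact (Set.Icc T T₁ ∩ f ⁻¹' (Set.Iic k)) :=
    isCompact_Icc.of_isClosed_subset hcl Set.inter_subset_left
  obtain ⟨τ, ⟨hτI, hτk⟩, hmin⟩ := hcpt.exists_isLeast ⟨t, ⟨ht, ht1⟩, hcon⟩
  have hτk : f τ ≤ k := hτk
  have hlt : ∀ u, T ≤ u → u < τ → k < f u := by
    intro u hu1 hu2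
    by_contra h
    have := hmin ⟨⟨hu1, hu2.le.trans hτI.2⟩, not_lt.mp h⟩
    linarith
  have hTτ : T < τ := by
    rcases hτI.1.lt_or_eq with h | h
    · exact h
    · rw [← h] at hτk; linarith
  have hev : ∀ᶠ u in nhdsWithin τ (Set.Iio τ), k < f u := by
    filter_upwards [Ioo_mem_nhdsLT hTτ] with u hu using hlt u hu.1.le hu.2
  have hd := hf τ hτI.1 hτI.2
  have hge : k ≤ f τ := by
    have h1 : Tendsto f (nhdsWithin τ (Set.Iio τ)) (nhds (f τ)) :=
      hd.continuousAt.tendsto.mono_left nhdsWithin_le_nhds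
    exact ge_of_tendsto h1 (hev.mono fun _ h => h.le)
  have heq : f τ = k := le_antisymm hτk hge
  have hpos := hb τ hτI.1 hτI.2 (by
    intro u h1 h2
    rcases h2.lt_or_eq with h | h
    · exact (hlt u h1 h).le
    · rw [h]; exact hge) heq
  have hs := (hasDerivAt_iff_tendsto_slope.mp hd).eventually (lt_mem_nhds hpos)
  have hs' : ∀ᶠ u in nhdsWithin τ (Set.Iio τ), 0 < slope f τ u :=
    hs.filter_mono (nhdsWithin_mono _ (fun u hu => ne_of_lt hu))
  obtain ⟨u, ⟨h1, h2⟩, h3⟩ := ((hs'.and hev).and self_mem_nhdsWithin).exists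
  have h3 : u < τ := h3
  rw [slope_def_field] at h1
  have : (f u - f τ) / (u - τ) ≤ 0 :=
    div_nonpos_of_nonneg_of_nonpos (by linarith) (by linarith)
  linarith

/-- Eventual entry lemma. -/
lemma chem_entry (f f' : ℝ → ℝ) (T k η : ℝ) (hη : 0 < η)
    (hf : ∀ t, T ≤ t → HasDerivAt f (f' t) t)
    (hb : ∀ t, T ≤ t → f t ≤ k → η ≤ f' t) :
    ∃ T' ≥ T, ∀ t ≥ T', k < f t := by
  by_cases h : ∃ T' ≥ T, k < f T'
  · obtain ⟨T', hT', hk⟩ := h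
    refine ⟨T', hT', fun t ht => ?_⟩
    refine chem_barrier f f' T' t k (fun u hu _ => hf u (le_trans hT' hu)) hk ?_ t ht le_rfl
    intro u hu _ _ he
    exact lt_of_lt_of_le hη (hb u (le_trans hT' hu) he.le)
  · exfalso
    push Not at h
    have hg : ∀ t, T ≤ t → f T - 1 + η / 2 * (t - T) < f t := by
      intro t ht
      have := chem_barrier (fun u => f u - η / 2 * (u - T)) (fun u => f' u - η / 2 * 1) T t
        (f T - 1) (fun u hu _ => (hf u hu).sub (((hasDerivAt_id u).sub_const T).const_mul _))
        (by simp) (fun u hu _ _ _ => by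
          have := hb u hu (h u hu); linarith) t ht le_rfl
      linarith
    have hkT := h T le_rfl
    have h1 := hg (T + 2 * (k - f T + 1) / η) (by
      have : 0 ≤ 2 * (k - f T + 1) / η := by
        apply div_nonneg _ hη.le; linarith
      linarith)
    have h2 := h (T + 2 * (k - f T + 1) / η) (by
      have : 0 ≤ 2 * (k - f T + 1) / η := by
        apply div_nonneg _ hη.le; linarith
      linarith)
    have h3 : η / 2 * (T + 2 * (k - f T + 1) / η - T) = k - f T + 1 := by
      field_simp; ring
    linarith

set_option maxHeartbeats 4000000 in
/-- strong persistence of the total biomass under the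
condition `ν + b₂ < z*_l/(a + z*_u/c)`. -/
theorem chemostat_transformed_persistence
    (s_in a m c b ν r₁ r₂ b₁ b₂ : ℝ)
    (hs_in : 0 < s_in) (ha : 0 < a) (hc : 0 < c) (hcm : c ≤ m)
    (hb : 0 < b) (hb1 : b ≤ 1) (hν : 0 < ν) (hr₁ : 0 < r₁) (hr₂ : 0 < r₂)
    (hb₁ : 0 < b₁) (hb₁₂ : b₁ ≤ b₂)
    (d : ℝ → ℝ) (hd_cont : Continuous d)
    (hd_bounds : ∀ t, b₁ ≤ d t ∧ d t ≤ b₂)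
    (ξl zl zu : ℝ) (hξl : ξl = r₂ / (b₂ + r₁ + r₂))
    (hzl : zl = c * s_in * b₁ / (b₂ + ν - (c * b * ν / m) * ξl))
    (hzu : zu = c * s_in * b₂ / (ξl * b₁))
    (hcond : ν + b₂ < zl / (a + zu / c))
    (xt : ℝ) (hxt : xt = (zl - (ν + b₂) * (a + zu / c)) / (m + c))
    (s x ξ : ℝ → ℝ)
    (h0 : 0 < s 0 ∧ 0 < x 0 ∧ ξ 0 ∈ Set.Ioo (0:ℝ) 1)
    (hs : ∀ t ∈ Set.Ici (0:ℝ), HasDerivAt s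
      (d t * (s_in - s t) - (m * s t / (a + s t)) * x t + b * ν * (ξ t * x t)) t)
    (hx : ∀ t ∈ Set.Ici (0:ℝ), HasDerivAt x
      (-ν * x t - d t * (ξ t * x t) + (c * s t / (a + s t)) * x t) t)
    (hξ : ∀ t ∈ Set.Ici (0:ℝ), HasDerivAt ξ
      (-d t * (ξ t * (1 - ξ t)) - r₁ * ξ t + r₂ * (1 - ξ t)) t) :
    0 < xt ∧ (∃ T ≥ (0:ℝ), ∀ t ≥ T, xt < x t) ∧ xt ≤ liminf x atTop := by
  have hm : 0 < m := lt_of_lt_of_le hc hcm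
  have hb₂ : 0 < b₂ := lt_of_lt_of_le hb₁ hb₁₂
  have hK : 0 < b₂ + r₁ + r₂ := by positivity
  have hξl0 : 0 < ξl := by rw [hξl]; positivity
  have hξl1 : ξl < 1 := by rw [hξl, div_lt_one hK]; linarith
  have hξlK : ξl * (b₂ + r₁ + r₂) = r₂ := by rw [hξl]; field_simp
  obtain ⟨q, hq⟩ : ∃ q, q = c * b * ν / m := ⟨_, rfl⟩
  have hq0 : 0 < q := by rw [hq]; positivity
  have hqm : q * m = c * b * ν := by rw [hq]; field_simp
  have hcb : c * b ≤ m := (mul_le_of_le_one_right hc.le hb1).trans hcm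
  have hqν : q ≤ ν := by
    rw [hq, div_le_iff₀ hm, mul_comm ν m]
    exact mul_le_mul_of_nonneg_right hcb hν.le
  rw [← hq] at hzl
  obtain ⟨D, hD⟩ : ∃ D, D = b₂ + ν - q * ξl := ⟨_, rfl⟩
  rw [← hD] at hzl
  have hqξ : q * ξl ≤ ν := (mul_le_of_le_one_right hq0.le hξl1.le).trans hqν
  have hDb : b₂ ≤ D := by linarith
  have hD0 : 0 < D := by linarith
  have hDzl : D * zl = c * s_in * b₁ := by rw [hzl]; field_simp
  have hzl0 : 0 < zl := by rw [hzl]; positivity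
  have hzu0 : 0 < zu := by rw [hzu]; positivity
  have hEzu : ξl * b₁ * zu = c * s_in * b₂ := by rw [hzu]; field_simp
  have hA : 0 < a + zu / c := by positivity
  rw [lt_div_iff₀ hA] at hcond
  have hmc : 0 < m + c := by linarith
  have hxt0 : 0 < xt := by rw [hxt]; apply div_pos _ hmc; linarith
  have hxtm : xt * (m + c) = zl - (ν + b₂) * (a + zu / c) := by rw [hxt]; field_simp
  obtain ⟨hs0, hx0, hξ0⟩ := h0
  -- bounds on ξ
  have hξpos : ∀ t, 0 ≤ t → 0 < ξ t := by
    intro t ht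
    refine chem_barrier ξ _ 0 t 0 (fun u hu _ => hξ u hu) hξ0.1 ?_ t ht le_rfl
    intro u _ _ _ he
    rw [he]; simpa using hr₂
  have hξlt : ∀ t, 0 ≤ t → ξ t < 1 := by
    intro t ht
    have := chem_barrier (fun u => - ξ u) _ 0 t (-1) (fun u hu _ => (hξ u hu).neg)
      (by have := hξ0.2; simpa using this) (by
        intro u _ _ _ he
        have he : ξ u = 1 := by linarith
        rw [he]; simpa using hr₁) t ht le_rfl
    linarith
  have hdξ : ∀ t, 0 ≤ t → d t * ξ t ≤ b₂ := by
    intro t ht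
    have h1 : d t * ξ t ≤ b₂ * 1 :=
      mul_le_mul (hd_bounds t).2 (hξlt t ht).le (hξpos t ht).le hb₂.le
    linarith
  -- positivity of s and x
  have hxpos' : ∀ t, 0 ≤ t → (∀ u, 0 ≤ u → u ≤ t → 0 ≤ s u) → 0 < x t := by
    intro t ht hst
    have := chem_barrier (fun u => x u * exp ((ν + b₂ + 1) * u)) _ 0 t (x 0 / 2)
      (fun u hu _ => (hx u hu).mul (((hasDerivAt_id u).const_mul (ν + b₂ + 1)).exp))
      (by simp; linarith) (by
        intro u hu hut _ he
        have hsu := hst u hu hut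
        have hE := exp_pos ((ν + b₂ + 1) * u)
        have hxu : 0 < x u := by
          have : 0 < x u * exp ((ν + b₂ + 1) * u) := by rw [he]; linarith
          exact pos_of_mul_pos_left this hE.le
        have h1 : 0 ≤ c * s u / (a + s u) := by positivity
        have h2 : d u * ξ u ≤ b₂ := by
          exact hdξ u hu
        have h3 : 0 < (-ν - d u * ξ u + c * s u / (a + s u) + (ν + b₂ + 1)) := by linarith
        have h4 := mul_pos (mul_pos h3 hxu) hE
        simp only [id]
        linarith) t ht le_rfl
    have h5 : 0 < x t * exp ((ν + b₂ + 1) * t) := by linarith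
    exact pos_of_mul_pos_left h5 (exp_pos _).le
  have hspos : ∀ t, 0 ≤ t → 0 < s t := by
    intro t ht
    refine chem_barrier s _ 0 t 0 (fun u hu _ => hs u hu) hs0 ?_ t ht le_rfl
    intro u hu _ hall he
    have hxu := hxpos' u hu hall
    have hξu := hξpos u hu
    have hdu : 0 < d u := lt_of_lt_of_le hb₁ (hd_bounds u).1
    rw [he]
    simp only [mul_zero, zero_div, zero_mul, sub_zero]
    positivity
  have hxpos : ∀ t, 0 ≤ t → 0 < x t := fun t ht =>
    hxpos' t ht (fun u hu _ => (hspos u hu).le)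
  -- eventually ξ > ξl
  obtain ⟨T₁, hT₁, hξT⟩ := chem_entry ξ _ 0 ξl (min (r₂ / 2) (b₁ * ξl ^ 2 / 4))
    (by positivity) (fun u hu => hξ u hu) (by
      intro u hu hle
      have h1 := hξpos u hu
      have h2 := hξlt u hu
      obtain ⟨h3, h4⟩ := hd_bounds u
      have h5 : b₁ * ξ u ^ 2 ≤ d u * ξ u ^ 2 := by gcongr
      have h6 : d u * ξ u ≤ b₂ * ξ u := by gcongr
      rcases le_total (ξ u) (ξl / 2) with h | h
      · refine (min_le_left _ _).trans ?_
        have h7 : ξ u * (b₂ + r₁ + r₂) ≤ ξl / 2 * (b₂ + r₁ + r₂) := by gcongr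
        have h8 : 0 ≤ b₁ * ξ u ^ 2 := by positivity
        linarith
      · refine (min_le_right _ _).trans ?_
        have h7 : ξ u * (b₂ + r₁ + r₂) ≤ ξl * (b₂ + r₁ + r₂) := by gcongr
        have h8 : b₁ * (ξl / 2) ^ 2 ≤ b₁ * ξ u ^ 2 := by gcongr
        linarith)
  have hT₁ : 0 ≤ T₁ := hT₁
  obtain ⟨ε, hε⟩ : ∃ ε, ε = c * xt / (2 * (1 + (ν + b₂) / c)) := ⟨_, rfl⟩
  have hε0 : 0 < ε := by rw [hε]; positivity
  have hεe : ε * (1 + (ν + b₂) / c) = c * xt / 2 := by rw [hε]; field_simp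
  have hz : ∀ t, 0 ≤ t → HasDerivAt (fun u => c * s u + m * x u)
      (c * d t * s_in - d t * (c * s t) - (m * x t) * (ν + d t * ξ t - q * ξ t)) t := by
    intro t ht
    refine (((hs t ht).const_mul c).add ((hx t ht).const_mul m)).congr_deriv ?_
    linear_combination (- ξ t * x t) * hqm
  -- lower bound on z
  obtain ⟨T₂, hT₂, hzlow⟩ := chem_entry _ _ T₁ (zl - ε) (D * ε) (by positivity)
    (fun u hu => hz u (hT₁.trans hu)) (by
      intro u hu hle
      have hu0 := hT₁.trans hu
      have h1 := hξT u hu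
      have h2 := hξlt u hu0
      have h9 := hξpos u hu0
      obtain ⟨h3, h4⟩ := hd_bounds u
      have hsu : 0 < c * s u := mul_pos hc (hspos u hu0)
      have hxu : 0 < m * x u := mul_pos hm (hxpos u hu0)
      have h5 : c * s_in * b₁ ≤ c * s_in * d u := by gcongr
      have h6 : d u * (c * s u) ≤ D * (c * s u) := by gcongr; linarith
      have h7 : ν + d u * ξ u - q * ξ u ≤ D := by
        have : q * ξl ≤ q * ξ u := by gcongr
        have := hdξ u hu0
        linarith
      have h8 : (m * x u) * (ν + d u * ξ u - q * ξ u) ≤ (m * x u) * D := by gcongr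
      have h10 : D * (c * s u + m * x u) ≤ D * (zl - ε) := by gcongr
      linarith)
  -- upper bound on z
  obtain ⟨T₃, hT₃, hzup⟩ := chem_entry _ _ T₁ (-(zu + ε)) (ξl * b₁ * ε) (by positivity)
    (fun u hu => (hz u (hT₁.trans hu)).neg) (by
      intro u hu hle
      have hu0 := hT₁.trans hu
      have h1 := hξT u hu
      have h2 := hξlt u hu0
      have h9 := hξpos u hu0
      obtain ⟨h3, h4⟩ := hd_bounds u
      have hsu : 0 < c * s u := mul_pos hc (hspos u hu0)
      have hxu : 0 < m * x u := mul_pos hm (hxpos u hu0)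
      have h5 : c * s_in * d u ≤ c * s_in * b₂ := by gcongr
      have h6 : (ξl * b₁) * (c * s u) ≤ d u * (c * s u) := by
        gcongr
        exact (mul_le_of_le_one_left hb₁.le hξl1.le).trans h3
      have h7 : ξl * b₁ ≤ ν + d u * ξ u - q * ξ u := by
        have : q * ξ u ≤ ν := (mul_le_of_le_one_right hq0.le h2.le).trans hqν
        have : ξl * b₁ ≤ ξ u * d u := by gcongr
        linarith
      have h8 : (m * x u) * (ξl * b₁) ≤ (m * x u) * (ν + d u * ξ u - q * ξ u) := by gcongr
      have hle' : zu + ε ≤ c * s u + m * x u := by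
        simp only [Pi.neg_apply] at hle
        linarith
      have h10 : (ξl * b₁) * (zu + ε) ≤ (ξl * b₁) * (c * s u + m * x u) := by gcongr
      linarith)
  simp only [Pi.neg_apply] at hzup
  have hB : 0 < a + (zu + ε) / c := by positivity
  obtain ⟨B, hBe⟩ : ∃ B, B = a + (zu + ε) / c := ⟨_, rfl⟩
  rw [← hBe] at hB
  have hkey : zl - ε - m * xt - (ν + b₂) * B = c * xt / 2 := by
    have h1 : B = (a + zu / c) + ε / c := by rw [hBe]; ring
    have h2 : ε * (1 + (ν + b₂) / c) = ε + (ν + b₂) * (ε / c) := by ring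
    rw [h1]; linarith
  -- the biomass
  obtain ⟨T₄, hT₄, hfin⟩ := chem_entry (fun u => log (x u)) _ (max T₂ T₃) (log xt) (c * xt / 2 / B)
    (by positivity)
    (fun u hu => (hx u (hT₁.trans (le_trans hT₂ ((le_max_left _ _).trans hu)))).log
      (hxpos u (hT₁.trans (le_trans hT₂ ((le_max_left _ _).trans hu)))).ne') (by
      intro u hu hle
      have huT₂ : T₂ ≤ u := (le_max_left _ _).trans hu
      have huT₃ : T₃ ≤ u := (le_max_right _ _).trans hu
      have hu0 : 0 ≤ u := hT₁.trans (le_trans hT₂ huT₂)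
      have hxu := hxpos u hu0
      have hsu := hspos u hu0
      have hxle : x u ≤ xt := (log_le_log_iff hxu hxt0).mp hle
      have h1 := hzlow u huT₂
      have h2 := hzup u huT₃
      have h3 : a + s u ≤ B := by
        have : s u ≤ (zu + ε) / c := by
          rw [le_div_iff₀ hc]
          have := mul_pos hm hxu
          linarith
        linarith
      have h4 : c * s u / B ≤ c * s u / (a + s u) := by gcongr
      have h5 : d u * ξ u ≤ b₂ := by
        exact hdξ u hu0
      have h6 : m * x u ≤ m * xt := by gcongr
      have h7 : c * xt / 2 / B + (ν + b₂) ≤ c * s u / B := by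
        rw [div_add' _ _ _ hB.ne']
        gcongr
        linarith
      rw [le_div_iff₀ hxu]
      have h8 : c * xt / 2 / B ≤ -ν - d u * ξ u + c * s u / (a + s u) := by linarith
      have h9 := mul_le_mul_of_nonneg_right h8 hxu.le
      linarith)
  have hT₄0 : 0 ≤ T₄ := hT₁.trans (le_trans hT₂ ((le_max_left _ _).trans hT₄))
  have hfin' : ∀ t ≥ T₄, xt < x t := fun t ht =>
    (log_lt_log_iff hxt0 (hxpos t (hT₄0.trans ht))).mp (hfin t ht)
  refine ⟨hxt0, ⟨T₄, hT₄0, hfin'⟩, ?_⟩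
  have hbdd : IsBoundedUnder (· ≤ ·) atTop x := by
    refine ⟨(zu + ε) / m, ?_⟩
    rw [eventually_map]
    filter_upwards [eventually_ge_atTop T₃, eventually_ge_atTop 0] with t h1 h2
    rw [le_div_iff₀ hm]
    have := hzup t h1
    have := mul_pos hc (hspos t h2)
    linarith
  refine le_liminf_of_le hbdd.isCoboundedUnder_ge ?_
  filter_upwards [eventually_ge_atTop T₄] with t ht using (hfin' t ht).le
end

section
/- Let (s, x, ξ) : [0, ∞) → ℝ³ be a C¹ solution of the transformed random chemostat system with s(0) > 0, x(0) > 0 and ξ(0) ∈ (0,1), and set s̃ = b₁ s_in/(b₂ + 2 z*_u/a) > 0. Then there exists T ≥ 0 such that s(t) > s̃ for all t ≥ T; in particular liminf_{t→∞} s(t) ≥ s̃ > 0, i.e. the substrate concentration admits a positive deterministic asymptotic lower bound. -/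
open Real Filter

lemma first_zero_pos (f : ℝ → ℝ) (hf : ContinuousOn f (Set.Ici 0)) (h0 : 0 < f 0)
    (h : ∀ t > 0, (∀ u, 0 ≤ u → u < t → 0 < f u) → f t ≠ 0) : ∀ t ≥ 0, 0 < f t := by
  by_contra! hcon
  obtain ⟨t1, ht1, hft1⟩ := hcon
  let S := Set.Icc 0 t1 ∩ f ⁻¹' (Set.Iic 0)
  have hSc : IsCompact S := by
    have hcl : IsClosed S :=
      (hf.mono Set.Icc_subset_Ici_self).preimage_isClosed_of_isClosed isClosed_Icc isClosed_Iic
    exact isCompact_Icc.of_isClosed_subset hcl Set.inter_subset_left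
  have hne : S.Nonempty := ⟨t1, ⟨ht1, le_refl _⟩, hft1⟩
  obtain ⟨τ, ⟨⟨hτ0, hτ1⟩, hfτ⟩, hmin⟩ := hSc.exists_isLeast hne
  have hfτ' : f τ ≤ 0 := hfτ
  have hpos : ∀ u, 0 ≤ u → u < τ → 0 < f u := by
    intro u hu hut
    by_contra! hc
    exact absurd (hmin ⟨⟨hu, by linarith⟩, hc⟩) (not_le.mpr hut)
  have hτpos : 0 < τ := by
    rcases hτ0.eq_or_lt with h1 | h1
    · rw [← h1] at hfτ'; linarith
    · exact h1
  apply h τ hτpos hpos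
  apply le_antisymm hfτ'
  by_contra! hneg
  have hivt := intermediate_value_Icc' hτ0 (hf.mono Set.Icc_subset_Ici_self)
  obtain ⟨u, ⟨hu0, hu1⟩, hu⟩ := hivt (show f τ / 2 ∈ Set.Icc (f τ) (f 0) from ⟨by linarith, by linarith⟩)
  rcases hu1.eq_or_lt with h1 | h1
  · rw [h1] at hu; linarith
  · have := hpos u hu0 h1; linarith

lemma deriv_nonpos_of_first_zero (f : ℝ → ℝ) (f' t : ℝ) (ht : 0 < t) (hf : HasDerivAt f f' t)
    (hpos : ∀ u, 0 ≤ u → u < t → 0 < f u) (h0 : f t = 0) : f' ≤ 0 := by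
  have h1 := (hasDerivAt_iff_tendsto_slope_left_right.mp hf).1
  refine le_of_tendsto h1 ?_
  have : Set.Ioo 0 t ∈ nhdsWithin t (Set.Iio t) := Ioo_mem_nhdsLT ht
  filter_upwards [this] with u hu
  rw [slope_def_field, h0]
  have := hpos u hu.1.le hu.2
  apply div_nonpos_of_nonneg_of_nonpos <;> linarith [hu.2]

lemma exp_mono_aux (f f' : ℝ → ℝ) (T t A K : ℝ) (hTt : T ≤ t)
    (hf : ∀ u ∈ Set.Icc T t, HasDerivAt f (f' u) u)
    (h : ∀ u ∈ Set.Ioo T t, K * A - K * f u ≤ f' u) :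
    (f T - A) * exp (K * T) ≤ (f t - A) * exp (K * t) := by
  have hder : ∀ u ∈ Set.Icc T t, HasDerivAt (fun u => (f u - A) * exp (K * u))
      (f' u * exp (K * u) + (f u - A) * (exp (K * u) * (K * 1))) u := by
    intro u hu
    exact ((hf u hu).sub_const A).mul (((hasDerivAt_id u).const_mul K).exp)
  have hm : MonotoneOn (fun u => (f u - A) * exp (K * u)) (Set.Icc T t) := by
    apply monotoneOn_of_deriv_nonneg (convex_Icc _ _)
    · intro u hu; exact (hder u hu).continuousAt.continuousWithinAt
    · intro u hu
      rw [interior_Icc] at hu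
      exact (hder u ⟨hu.1.le, hu.2.le⟩).differentiableAt.differentiableWithinAt
    · intro u hu
      rw [interior_Icc] at hu
      rw [(hder u ⟨hu.1.le, hu.2.le⟩).deriv]
      have := h u hu
      have e := exp_pos (K * u)
      have : 0 ≤ (f' u + K * (f u - A)) * exp (K * u) := mul_nonneg (by linarith) e.le
      linarith
  exact hm ⟨le_refl _, hTt⟩ ⟨hTt, le_refl _⟩ hTt

lemma eventually_gt_aux (f f' : ℝ → ℝ) (T A K L : ℝ) (hK : 0 < K) (hL : L < A)
    (hf : ∀ u, T ≤ u → HasDerivAt f (f' u) u)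
    (h : ∀ u, T ≤ u → K * A - K * f u ≤ f' u) :
    ∃ T' ≥ T, ∀ t ≥ T', L < f t := by
  have hlim : Tendsto (fun t : ℝ => A + (f T - A) * exp (K * T) * exp (-(K * t))) atTop (nhds (A + (f T - A) * exp (K * T) * 0)) := by
    apply Tendsto.const_add
    apply Tendsto.const_mul
    exact tendsto_exp_neg_atTop_nhds_zero.comp (tendsto_id.const_mul_atTop hK)
  rw [mul_zero, add_zero] at hlim
  obtain ⟨T0, hT0⟩ := eventually_atTop.mp (hlim.eventually (lt_mem_nhds hL))
  refine ⟨max T T0, le_max_left _ _, fun t ht => ?_⟩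
  have hTt : T ≤ t := (le_max_left _ _).trans ht
  have h1 := exp_mono_aux f f' T t A K hTt (fun u hu => hf u hu.1) (fun u hu => h u hu.1.le)
  have h2 := hT0 t ((le_max_right _ _).trans ht)
  have h3 := mul_le_mul_of_nonneg_right h1 (exp_pos (-(K * t))).le
  rw [mul_assoc (f t - A), ← exp_add, add_neg_cancel, exp_zero] at h3
  linarith

/-- positive deterministic asymptotic lower bound for the
substrate concentration. -/
theorem chemostat_transformed_substrate_lower_bound
    (s_in a m c b ν r₁ r₂ b₁ b₂ : ℝ)
    (hs_in : 0 < s_in) (ha : 0 < a) (hc : 0 < c) (hcm : c ≤ m)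
    (hb : 0 < b) (hb1 : b ≤ 1) (hν : 0 < ν) (hr₁ : 0 < r₁) (hr₂ : 0 < r₂)
    (hb₁ : 0 < b₁) (hb₁₂ : b₁ ≤ b₂)
    (d : ℝ → ℝ) (hd_cont : Continuous d)
    (hd_bounds : ∀ t, b₁ ≤ d t ∧ d t ≤ b₂)
    (ξl zl zu : ℝ) (hξl : ξl = r₂ / (b₂ + r₁ + r₂))
    (hzl : zl = c * s_in * b₁ / (b₂ + ν - (c * b * ν / m) * ξl))
    (hzu : zu = c * s_in * b₂ / (ξl * b₁))
    (st : ℝ) (hst : st = b₁ * s_in / (b₂ + 2 * zu / a))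
    (s x ξ : ℝ → ℝ)
    (h0 : 0 < s 0 ∧ 0 < x 0 ∧ ξ 0 ∈ Set.Ioo (0:ℝ) 1)
    (hs : ∀ t ∈ Set.Ici (0:ℝ), HasDerivAt s
      (d t * (s_in - s t) - (m * s t / (a + s t)) * x t + b * ν * (ξ t * x t)) t)
    (hx : ∀ t ∈ Set.Ici (0:ℝ), HasDerivAt x
      (-ν * x t - d t * (ξ t * x t) + (c * s t / (a + s t)) * x t) t)
    (hξ : ∀ t ∈ Set.Ici (0:ℝ), HasDerivAt ξ
      (-d t * (ξ t * (1 - ξ t)) - r₁ * ξ t + r₂ * (1 - ξ t)) t) :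
    0 < st ∧ (∃ T ≥ (0:ℝ), ∀ t ≥ T, st < s t) ∧ st ≤ liminf s atTop := by
  obtain ⟨hs0, hx0, hξ0, hξ01⟩ := h0
  have hm : 0 < m := by linarith
  have hb₂ : 0 < b₂ := by linarith
  have hξlpos : 0 < ξl := by rw [hξl]; positivity
  have hzupos : 0 < zu := by rw [hzu]; positivity
  have hstpos : 0 < st := by rw [hst]; positivity
  have hξpos : ∀ t ≥ 0, 0 < ξ t := by
    apply first_zero_pos ξ (fun t ht => (hξ t ht).continuousAt.continuousWithinAt) hξ0
    intro t ht hp hz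
    have := deriv_nonpos_of_first_zero ξ _ t ht (hξ t ht.le) hp hz
    rw [hz] at this
    linarith
  have hξlt : ∀ t ≥ 0, 0 < 1 - ξ t := by
    apply first_zero_pos (fun t => 1 - ξ t)
      (fun t ht => ((hξ t ht).const_sub 1).continuousAt.continuousWithinAt) (by linarith)
    intro t ht hp hz
    have := deriv_nonpos_of_first_zero _ _ t ht ((hξ t ht.le).const_sub 1) hp hz
    rw [hz] at this
    nlinarith
  have hsx : ∀ t ≥ 0, 0 < min (s t) (x t) := by
    apply first_zero_pos (fun t => min (s t) (x t))
      (fun t ht => ((hs t ht).continuousAt.continuousWithinAt).inf ((hx t ht).continuousAt.continuousWithinAt))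
      (lt_min hs0 hx0)
    intro t ht hp hz
    have hxt : 0 < x t := by
      have h1 := exp_mono_aux x _ 0 t 0 (ν + b₂) ht.le (fun u hu => hx u hu.1) (by
        intro u hu
        have hsu := (lt_min_iff.mp (hp u hu.1.le hu.2)).1
        have hxu := (lt_min_iff.mp (hp u hu.1.le hu.2)).2
        have q1 : 0 ≤ c * s u / (a + s u) * x u := by positivity
        have q2 : d u * (ξ u * x u) ≤ b₂ * (1 * x u) := by
          have := hξlt u hu.1.le
          have := hξpos u hu.1.le
          have := (hd_bounds u).2
          gcongr
          linarith
        linarith)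
      simp only [sub_zero, mul_zero, exp_zero, mul_one] at h1
      exact pos_of_mul_pos_left (lt_of_lt_of_le hx0 h1) (exp_pos _).le
    have hst0 : s t = 0 := by
      rcases min_choice (s t) (x t) with h1 | h1
      · rw [← h1]; exact hz
      · rw [h1] at hz; linarith
    have := deriv_nonpos_of_first_zero s _ t ht (hs t ht.le)
      (fun u h1 h2 => (lt_min_iff.mp (hp u h1 h2)).1) hst0
    rw [hst0] at this
    have q1 : 0 < d t * s_in := mul_pos (by linarith [(hd_bounds t).1]) hs_in
    have q2 : 0 < b * ν * (ξ t * x t) := by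
      have := hξpos t ht.le
      positivity
    simp only [sub_zero, mul_zero, zero_div, zero_mul] at this
    linarith
  have hspos : ∀ t ≥ 0, 0 < s t := fun t ht => (lt_min_iff.mp (hsx t ht)).1
  have hxpos : ∀ t ≥ 0, 0 < x t := fun t ht => (lt_min_iff.mp (hsx t ht)).2
  -- lower bound for the proportion
  obtain ⟨T1, hT1, hξb⟩ := eventually_gt_aux ξ _ 0 ξl (b₂ + r₁ + r₂) (3 / 4 * ξl) (by positivity)
    (by linarith) (fun u hu => hξ u hu) (by
      intro u hu
      have e : (b₂ + r₁ + r₂) * ξl = r₂ := by rw [hξl]; field_simp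
      rw [e]
      have := hξlt u hu
      have := hξpos u hu
      have : d u * (ξ u * (1 - ξ u)) ≤ b₂ * (ξ u * 1) := by
        have := (hd_bounds u).2
        gcongr
        linarith
      linarith)
  -- upper bound for the total mass
  obtain ⟨T2, hT2, hzb⟩ := eventually_gt_aux (fun t => -(c * s t + m * x t)) _ T1 (-(4 / 3 * zu))
    (b₁ * (3 / 4 * ξl)) (-(3 / 2 * zu)) (by positivity) (by linarith)
    (fun u hu => (((hs u (hT1.le.trans hu)).const_mul c).add
      ((hx u (hT1.le.trans hu)).const_mul m)).neg) (by
      intro u hu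
      have hu0 : 0 ≤ u := hT1.le.trans hu
      have e : (b₁ * (3 / 4 * ξl)) * (4 / 3 * zu) = c * s_in * b₂ := by rw [hzu]; field_simp
      have p1 := hξlt u hu0
      have p2 := hξpos u hu0
      have p3 := hξb u hu
      have p4 := hspos u hu0
      have p5 := hxpos u hu0
      have p6 := hd_bounds u
      have q1 : c * (b * ν * (ξ u * x u)) ≤ m * (1 * ν * (1 * x u)) := by
        gcongr
        linarith
      have q2 : (b₁ * (3 / 4 * ξl)) * (c * s u) ≤ d u * (c * s u) := by
        have : b₁ * (3 / 4 * ξl) ≤ d u * 1 := by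
          have := p6.1
          have : 3 / 4 * ξl ≤ 1 := by linarith
          gcongr
          linarith
        rw [mul_one] at this
        gcongr
      have q3 : (b₁ * (3 / 4 * ξl)) * (m * x u) ≤ (d u * ξ u) * (m * x u) := by
        have := p6.1
        gcongr
        linarith
      have q4 : c * s_in * d u ≤ c * s_in * b₂ := by
        have := p6.2
        gcongr
      have q5 : c * (m * s u / (a + s u) * x u) = m * (c * s u / (a + s u) * x u) := by ring
      linarith)
  -- lower bound for the substrate
  have hT20 : 0 ≤ T2 := le_trans hT1 hT2
  obtain ⟨T3, hT3, hsb⟩ := eventually_gt_aux s _ T2 (b₁ * s_in / (b₂ + 3 / 2 * zu / a))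
    (b₂ + 3 / 2 * zu / a) st (by positivity) (by
      rw [hst]
      gcongr
      norm_num)
    (fun u hu => hs u (hT20.trans hu)) (by
      intro u hu
      have hu0 : 0 ≤ u := hT20.trans hu
      have e : (b₂ + 3 / 2 * zu / a) * (b₁ * s_in / (b₂ + 3 / 2 * zu / a)) = b₁ * s_in := by
        field_simp
      rw [e]
      have p2 := hξpos u hu0
      have p3 := hzb u hu
      have p4 := hspos u hu0
      have p5 := hxpos u hu0
      have p6 := hd_bounds u
      have q1 : m * s u / (a + s u) * x u ≤ 3 / 2 * zu / a * s u := by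
        have k1 : m * s u / (a + s u) * x u = (m * x u) * s u / (a + s u) := by ring
        have k2 : 3 / 2 * zu / a * s u = (3 / 2 * zu) * s u / a := by ring
        rw [k1, k2]
        have : m * x u ≤ 3 / 2 * zu := by
          have : 0 < c * s u := by positivity
          linarith
        gcongr
        linarith
      have q2 : b₁ * s_in ≤ d u * s_in := by
        have := p6.1
        gcongr
      have q3 : d u * s u ≤ b₂ * s u := by
        have := p6.2
        gcongr
      have q4 : 0 < b * ν * (ξ u * x u) := by positivity
      linarith)
  have hT30 : 0 ≤ T3 := le_trans hT20 hT3
  refine ⟨hstpos, ⟨T3, hT30, hsb⟩, ?_⟩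
  apply le_liminf_of_le
  · apply IsBoundedUnder.isCoboundedUnder_ge
    refine ⟨3 / 2 * zu / c, ?_⟩
    rw [eventually_map]
    filter_upwards [eventually_ge_atTop T2] with u hu
    have p3 := hzb u hu
    have p5 : 0 < m * x u := mul_pos hm (hxpos u (hT20.trans hu))
    rw [le_div_iff₀ hc]
    linarith
  · filter_upwards [eventually_ge_atTop T3] with u hu
    exact (hsb u hu).le
end

section
/- Assume the persistence condition ν + b₂ < z*_l/(a + z*_u/c) holds, and set x̃ = (z*_l − (ν + b₂)(a + z*_u/c))/(m + c) > 0. Let (s, x₁, x₂) : [0, ∞) → ℝ³ be a C¹ solution of the random chemostat model with wall growth with s(0) > 0, x₁(0) > 0 and x₂(0) > 0. Then liminf_{t→∞} x₁(t) ≥ ξ*_l x̃ > 0 and liminf_{t→∞} x₂(t) ≥ (1 − ξ*_u) x̃ > 0, where 1 − ξ*_u = r₁/(b₁+r₁+r₂); that is, both species (the one in the liquid medium and the one attached to the walls) persist and coexist in the strong sense. -/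
open Real Filter

/-- If `f' ≥ δ > 0` whenever `f ≤ L`, then eventually `L ≤ f`. -/
lemma eventually_ge_of_deriv (f f' : ℝ → ℝ) (T L δ : ℝ) (hδ : 0 < δ)
    (hf : ∀ t, T ≤ t → HasDerivAt f (f' t) t)
    (h : ∀ t, T ≤ t → f t ≤ L → δ ≤ f' t) : ∀ᶠ t in atTop, L ≤ f t := by
  have h1 : ∃ t0, T ≤ t0 ∧ L ≤ f t0 := by
    by_contra! hcon
    have hmono : MonotoneOn (fun t => f t - δ * t) (Set.Ici T) := by
      apply monotoneOn_of_hasDerivWithinAt_nonneg (f' := fun t => f' t - δ) (convex_Ici T)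
      · intro t ht
        exact ((hf t ht).continuousAt.sub (by fun_prop)).continuousWithinAt
      · intro t ht
        rw [interior_Ici] at ht
        have := (hf t (le_of_lt ht)).sub ((hasDerivAt_id t).const_mul δ)
        simp only [mul_one] at this
        exact this.hasDerivWithinAt
      · intro t ht
        rw [interior_Ici] at ht
        have := h t (le_of_lt ht) (hcon t (le_of_lt ht)).le
        linarith
    have hL := hcon T le_rfl
    set t1 := T + (L - f T) / δ with ht1
    have hpos : 0 < (L - f T) / δ := div_pos (by linarith) hδ
    have hT1 : T ≤ t1 := by linarith
    have h2 := hmono (Set.mem_Ici.2 le_rfl) (Set.mem_Ici.2 hT1) hT1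
    have h3 := hcon t1 hT1
    have h4 : δ * t1 = δ * T + (L - f T) := by rw [ht1]; field_simp
    simp only at h2
    linarith
  obtain ⟨t0, ht0, hL0⟩ := h1
  filter_upwards [eventually_ge_atTop t0] with t ht
  have := image_le_of_deriv_right_lt_deriv_boundary' (f := fun _ => L) (f' := fun _ => 0)
    (a := t0) (b := t) (B := f) (B' := f') continuousOn_const
    (fun x _ => hasDerivWithinAt_const _ _ _) hL0
    (fun x hx => (hf x (ht0.trans hx.1)).continuousAt.continuousWithinAt)
    (fun x hx => (hf x (ht0.trans hx.1)).hasDerivWithinAt)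
    (fun x hx hxe => lt_of_lt_of_le hδ (h x (ht0.trans hx.1) (le_of_eq hxe.symm)))
  exact this ⟨ht, le_rfl⟩

lemma pos_of_deriv (f f' : ℝ → ℝ) (T k : ℝ) (hT : 0 ≤ T)
    (hf : ∀ t, 0 ≤ t → HasDerivAt f (f' t) t) (h0 : 0 < f 0)
    (h : ∀ t, 0 ≤ t → t < T → - k * f t ≤ f' t) : 0 < f T := by
  have hmono : MonotoneOn (fun t => f t * Real.exp (k * t)) (Set.Icc 0 T) := by
    apply monotoneOn_of_hasDerivWithinAt_nonneg
      (f' := fun t => f' t * Real.exp (k * t) + f t * (Real.exp (k * t) * (k * 1))) (convex_Icc 0 T)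
    · intro t ht
      exact ((hf t ht.1).continuousAt.mul (by fun_prop)).continuousWithinAt
    · intro t ht
      rw [interior_Icc] at ht
      exact ((hf t ht.1.le).mul (((hasDerivAt_id t).const_mul k).exp)).hasDerivWithinAt
    · intro t ht
      rw [interior_Icc] at ht
      have h1 := h t ht.1.le ht.2
      have : 0 ≤ (f' t + k * f t) * Real.exp (k * t) :=
        mul_nonneg (by linarith) (Real.exp_pos _).le
      linarith
  have h2 := hmono ⟨le_rfl, hT⟩ ⟨hT, le_rfl⟩ hT
  simp only [mul_zero, Real.exp_zero, mul_one] at h2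
  by_contra! hc
  have := mul_nonpos_of_nonpos_of_nonneg hc (Real.exp_pos (k * T)).le
  linarith

set_option maxHeartbeats 2000000 in
/-- strong persistence and coexistence of both species in the
random chemostat model with wall growth. -/
theorem chemostat_wall_growth_coexistence
    (s_in a m c b ν r₁ r₂ b₁ b₂ : ℝ)
    (hs_in : 0 < s_in) (ha : 0 < a) (hc : 0 < c) (hcm : c ≤ m)
    (hb : 0 < b) (hb1 : b ≤ 1) (hν : 0 < ν) (hr₁ : 0 < r₁) (hr₂ : 0 < r₂)
    (hb₁ : 0 < b₁) (hb₁₂ : b₁ ≤ b₂)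
    (d : ℝ → ℝ) (hd_cont : Continuous d)
    (hd_bounds : ∀ t, b₁ ≤ d t ∧ d t ≤ b₂)
    (ξl ξu zl zu : ℝ) (hξl : ξl = r₂ / (b₂ + r₁ + r₂))
    (hξu : ξu = (b₁ + r₂) / (b₁ + r₁ + r₂))
    (hzl : zl = c * s_in * b₁ / (b₂ + ν - (c * b * ν / m) * ξl))
    (hzu : zu = c * s_in * b₂ / (ξl * b₁))
    (hcond : ν + b₂ < zl / (a + zu / c))
    (xt : ℝ) (hxt : xt = (zl - (ν + b₂) * (a + zu / c)) / (m + c))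
    (s x₁ x₂ : ℝ → ℝ)
    (h0 : 0 < s 0 ∧ 0 < x₁ 0 ∧ 0 < x₂ 0)
    (hs : ∀ t ∈ Set.Ici (0:ℝ), HasDerivAt s
      (d t * (s_in - s t) - (m * s t / (a + s t)) * x₁ t
        - (m * s t / (a + s t)) * x₂ t + b * ν * x₁ t) t)
    (hx₁ : ∀ t ∈ Set.Ici (0:ℝ), HasDerivAt x₁
      (-(ν + d t) * x₁ t + (c * s t / (a + s t)) * x₁ t - r₁ * x₁ t + r₂ * x₂ t) t)
    (hx₂ : ∀ t ∈ Set.Ici (0:ℝ), HasDerivAt x₂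
      (-ν * x₂ t + (c * s t / (a + s t)) * x₂ t + r₁ * x₁ t - r₂ * x₂ t) t) :
    (0 < ξl * xt ∧ ξl * xt ≤ liminf x₁ atTop) ∧
    (0 < (1 - ξu) * xt ∧ (1 - ξu) * xt ≤ liminf x₂ atTop) ∧
    1 - ξu = r₁ / (b₁ + r₁ + r₂) := by
  have hm : 0 < m := lt_of_lt_of_le hc hcm
  have hb₂ : 0 < b₂ := lt_of_lt_of_le hb₁ hb₁₂
  obtain ⟨hs0, hx10, hx20⟩ := h0
  simp only [mul_div_assoc, Set.mem_Ici] at hs hx₁ hx₂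
  have hμ : ∀ t, 0 ≤ s t → 0 ≤ s t / (a + s t) ∧ s t / (a + s t) ≤ s t / a := by
    intro t ht
    refine ⟨by positivity, ?_⟩
    apply div_le_div_of_nonneg_left ht ha (by linarith)
  -- positivity
  have hpos : ∀ t, 0 ≤ t → 0 < s t ∧ 0 < x₁ t ∧ 0 < x₂ t := by
    by_contra! hcon
    obtain ⟨tb, htb, hbad⟩ := hcon
    let g : ℝ → ℝ := fun t => min (s t) (min (x₁ t) (x₂ t))
    have hg : ContinuousOn g (Set.Ici 0) := by
      intro t ht
      exact ContinuousAt.continuousWithinAt ((hs t ht).continuousAt.min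
        ((hx₁ t ht).continuousAt.min (hx₂ t ht).continuousAt))
    have hgp : ∀ t, 0 < g t ↔ 0 < s t ∧ 0 < x₁ t ∧ 0 < x₂ t := by
      intro t; simp [g]
    let S : Set ℝ := Set.Ici 0 ∩ g ⁻¹' (Set.Iic 0)
    have hScl : IsClosed S := hg.preimage_isClosed_of_isClosed isClosed_Ici isClosed_Iic
    have hSne : S.Nonempty := by
      refine ⟨tb, htb, ?_⟩
      by_contra hh
      have := (hgp tb).1 (not_le.1 hh)
      exact absurd (hbad this.1 this.2.1) (not_le.2 this.2.2)
    have hSb : BddBelow S := ⟨0, fun t ht => ht.1⟩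
    have hmem := hScl.csInf_mem hSne hSb
    set t0 := sInf S with ht0
    have ht00 : 0 ≤ t0 := hmem.1
    have hbef : ∀ t, 0 ≤ t → t < t0 → 0 < s t ∧ 0 < x₁ t ∧ 0 < x₂ t := by
      intro t ht htt
      rw [← hgp]
      by_contra hh
      exact absurd (csInf_le hSb (show t ∈ S from ⟨ht, not_lt.1 hh⟩)) (not_le.2 htt)
    have hcx : ContinuousOn (fun t => x₁ t + x₂ t) (Set.Icc 0 t0) := fun t ht =>
      ((hx₁ t ht.1).continuousAt.add (hx₂ t ht.1).continuousAt).continuousWithinAt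
    obtain ⟨M, hM⟩ := (isCompact_Icc.image_of_continuousOn hcx).bddAbove
    have hM' : ∀ t, 0 ≤ t → t < t0 → x₁ t + x₂ t ≤ M := fun t h1 h2 =>
      hM ⟨t, ⟨h1, h2.le⟩, rfl⟩
    have p1 : 0 < x₁ t0 := by
      refine pos_of_deriv x₁ _ t0 (ν + b₂ + r₁) ht00 hx₁ hx10 ?_
      intro t ht htt
      obtain ⟨q1, q2, q3⟩ := hbef t ht htt
      have e1 := mul_nonneg (sub_nonneg.2 (hd_bounds t).2) q2.le
      have e2 := mul_nonneg (mul_nonneg hc.le (hμ t q1.le).1) q2.le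
      have e3 := mul_pos hr₂ q3
      linarith
    have p2 : 0 < x₂ t0 := by
      refine pos_of_deriv x₂ _ t0 (ν + r₂) ht00 hx₂ hx20 ?_
      intro t ht htt
      obtain ⟨q1, q2, q3⟩ := hbef t ht htt
      have e2 := mul_nonneg (mul_nonneg hc.le (hμ t q1.le).1) q3.le
      have e3 := mul_pos hr₁ q2
      linarith
    have p3 : 0 < s t0 := by
      refine pos_of_deriv s _ t0 (b₂ + m / a * M) ht00 hs hs0 ?_
      intro t ht htt
      obtain ⟨q1, q2, q3⟩ := hbef t ht htt
      have e1 := mul_nonneg (sub_nonneg.2 (hd_bounds t).2) q1.le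
      have e2 := mul_nonneg (mul_nonneg hm.le (sub_nonneg.2 (hμ t q1.le).2)) (add_pos q2 q3).le
      have e3 := mul_nonneg (mul_nonneg (div_pos hm ha).le q1.le) (sub_nonneg.2 (hM' t ht htt))
      have e4 := mul_pos (mul_pos hb hν) q2
      have e5 := mul_pos (lt_of_lt_of_le hb₁ (hd_bounds t).1) hs_in
      have e6 : m * (s t / a) = m / a * s t := by ring
      have e7 : 0 ≤ m / a * s t * (x₁ t + x₂ t) - m * (s t / (a + s t)) * (x₁ t + x₂ t) := by
        rw [← e6]; linarith
      linarith
    exact absurd ((hgp t0).2 ⟨p3, p1, p2⟩) (not_lt.2 hmem.2)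
  -- constants
  have hB : 0 < b₂ + r₁ + r₂ := by positivity
  have hB1 : 0 < b₁ + r₁ + r₂ := by positivity
  have hξl0 : 0 < ξl := by rw [hξl]; positivity
  have hξl1 : ξl < 1 := by rw [hξl, div_lt_one hB]; linarith
  have hξlB : ξl * (b₂ + r₁ + r₂) = r₂ := by rw [hξl]; field_simp
  have hξuB : ξu * (b₁ + r₁ + r₂) = b₁ + r₂ := by rw [hξu]; field_simp
  have hξu' : 1 - ξu = r₁ / (b₁ + r₁ + r₂) := by rw [hξu]; field_simp; ring
  have hξu1 : 0 < 1 - ξu := by rw [hξu']; positivity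
  have hcb : c * b ≤ m := by nlinarith
  have hκ : c * b * ν / m ≤ ν := by
    rw [div_le_iff₀ hm]
    nlinarith
  have hκ0 : 0 < c * b * ν / m := by positivity
  set κ := c * b * ν / m with hκdef
  have hκm : κ * m = c * b * ν := by rw [hκdef]; field_simp
  have hD : 0 < b₂ + ν - κ * ξl := by nlinarith
  have hzlD : zl * (b₂ + ν - κ * ξl) = c * s_in * b₁ := by rw [hzl]; field_simp
  have hzuD : zu * (ξl * b₁) = c * s_in * b₂ := by rw [hzu]; field_simp
  have hzu0 : 0 < zu := by rw [hzu]; positivity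
  have hA : 0 < a + zu / c := by positivity
  have hY : 0 < zl - (ν + b₂) * (a + zu / c) := by
    rw [lt_div_iff₀ hA] at hcond; linarith
  have hmc : 0 < m + c := by positivity
  have hxt0 : 0 < xt := by rw [hxt]; positivity
  have hxtm : xt * (m + c) = zl - (ν + b₂) * (a + zu / c) := by rw [hxt]; field_simp
  -- total biomass
  have hX : ∀ t, 0 ≤ t → HasDerivAt (fun t => x₁ t + x₂ t)
      (-ν * (x₁ t + x₂ t) - d t * x₁ t + c * (s t / (a + s t)) * (x₁ t + x₂ t)) t := by
    intro t ht
    exact ((hx₁ t ht).add (hx₂ t ht)).congr_deriv (by ring)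
  have hξ : ∀ t, 0 ≤ t → HasDerivAt (fun t => x₁ t / (x₁ t + x₂ t))
      (r₂ - (d t + r₁ + r₂) * (x₁ t / (x₁ t + x₂ t)) + d t * (x₁ t / (x₁ t + x₂ t)) ^ 2) t := by
    intro t ht
    obtain ⟨q1, q2, q3⟩ := hpos t ht
    have hne : x₁ t + x₂ t ≠ 0 := by positivity
    refine ((hx₁ t ht).div (hX t ht) hne).congr_deriv ?_
    generalize s t / (a + s t) = μ
    field_simp
    ring
  have hξ01 : ∀ t, 0 ≤ t → 0 < x₁ t / (x₁ t + x₂ t) ∧ x₁ t / (x₁ t + x₂ t) < 1 := by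
    intro t ht
    obtain ⟨q1, q2, q3⟩ := hpos t ht
    refine ⟨by positivity, ?_⟩
    rw [div_lt_one (by positivity)]; linarith
  have E1 : ∀ᶠ t in atTop, ξl ≤ x₁ t / (x₁ t + x₂ t) := by
    refine eventually_ge_of_deriv _ _ 0 ξl (b₂ * ξl ^ 2 / 2) (by positivity) hξ ?_
    intro t ht hle
    obtain ⟨h1, h2⟩ := hξ01 t ht
    generalize x₁ t / (x₁ t + x₂ t) = y at *
    have e1 := mul_nonneg (sub_nonneg.2 (hd_bounds t).2) (mul_nonneg h1.le (sub_nonneg.2 h2.le))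
    have e2 : b₂ * ξl ^ 2 / 2 ≤ b₂ * (y ^ 2 + (ξl - y)) := by
      have : ξl ^ 2 / 2 ≤ y ^ 2 + (ξl - y) := by
        nlinarith [sq_nonneg (2 * y - ξl), mul_nonneg (sub_nonneg.2 hle)
          (show 0 ≤ 1 - (ξl - y) by linarith)]
      nlinarith
    have e3 := mul_nonneg (add_pos hr₁ hr₂).le (sub_nonneg.2 hle)
    linarith
  have E2 : ∀ᶠ t in atTop, x₁ t / (x₁ t + x₂ t) ≤ ξu := by
    have hδ : 0 < (r₁ + r₂) * ξu - r₂ := by nlinarith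
    have := eventually_ge_of_deriv _ _ 0 (-ξu) _ hδ (fun t ht => (hξ t ht).neg) ?_
    · filter_upwards [this] with t ht
      simp only [Pi.neg_apply] at ht; linarith
    intro t ht hle
    obtain ⟨h1, h2⟩ := hξ01 t ht
    simp only [Pi.neg_apply] at hle
    generalize x₁ t / (x₁ t + x₂ t) = y at *
    have e1 := mul_nonneg (hb₁.le.trans (hd_bounds t).1) (mul_nonneg h1.le (sub_nonneg.2 h2.le))
    have e3 := mul_nonneg (add_pos hr₁ hr₂).le (show 0 ≤ y - ξu by linarith)
    linarith
  obtain ⟨T1, hT1⟩ := eventually_atTop.1 E1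
  set T := max T1 0 with hTdef
  have hT0 : ∀ t, T ≤ t → 0 ≤ t := fun t ht => (le_max_right _ _).trans ht
  have hTl : ∀ t, T ≤ t → ξl * (x₁ t + x₂ t) ≤ x₁ t := by
    intro t ht
    obtain ⟨q1, q2, q3⟩ := hpos t (hT0 t ht)
    exact (le_div_iff₀ (by positivity)).1 (hT1 t ((le_max_left _ _).trans ht))
  -- the variable z
  have hz : ∀ t, T ≤ t → HasDerivAt (fun t => c * s t + m * (x₁ t + x₂ t))
      (c * (d t * (s_in - s t)) + c * b * ν * x₁ t - m * ν * (x₁ t + x₂ t)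
        - m * d t * x₁ t) t := by
    intro t ht
    exact (((hs t (hT0 t ht)).const_mul c).add ((hX t (hT0 t ht)).const_mul m)).congr_deriv
      (by ring)
  set e := (c / 2 * xt) / (1 + (ν + b₂) / c) with he
  have he0 : 0 < e := by positivity
  have hee : e + (ν + b₂) * (e / c) = c / 2 * xt := by rw [he]; field_simp
  have E3 : ∀ᶠ t in atTop, zl - e ≤ c * s t + m * (x₁ t + x₂ t) := by
    refine eventually_ge_of_deriv _ _ T (zl - e) ((b₂ + ν - κ * ξl) * e) (by positivity) hz ?_
    intro t ht hle
    obtain ⟨q1, q2, q3⟩ := hpos t (hT0 t ht)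
    have hl := hTl t ht
    obtain ⟨d1, d2⟩ := hd_bounds t
    have e1 := mul_nonneg hD.le (sub_nonneg.2 hle)
    have e2 : 0 ≤ c * b * ν * (x₁ t - ξl * (x₁ t + x₂ t)) :=
      mul_nonneg (by positivity) (sub_nonneg.2 hl)
    have e3 : c * b * ν * (ξl * (x₁ t + x₂ t)) = κ * ξl * (m * (x₁ t + x₂ t)) := by
      rw [← hκm]; ring
    have e4 : 0 ≤ (ν - κ * ξl) * (c * s t) := mul_nonneg (by nlinarith) (by positivity)
    have e5 : 0 ≤ c * s_in * (d t - b₁) := mul_nonneg (by positivity) (by linarith)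
    have e6 : 0 ≤ c * s t * (b₂ - d t) := mul_nonneg (by positivity) (by linarith)
    have e7 : 0 ≤ m * x₁ t * (b₂ - d t) := mul_nonneg (by positivity) (by linarith)
    have e8 : 0 ≤ m * x₂ t * b₂ := by positivity
    linarith
  have E4 : ∀ᶠ t in atTop, c * s t + m * (x₁ t + x₂ t) ≤ zu + e := by
    have := eventually_ge_of_deriv _ _ T (-(zu + e)) ((ξl * b₁) * e) (by positivity)
      (fun t ht => (hz t ht).neg) ?_
    · filter_upwards [this] with t ht
      simp only [Pi.neg_apply] at ht; linarith
    intro t ht hle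
    obtain ⟨q1, q2, q3⟩ := hpos t (hT0 t ht)
    have hl := hTl t ht
    obtain ⟨d1, d2⟩ := hd_bounds t
    simp only [Pi.neg_apply] at hle
    have e1 := mul_nonneg (mul_pos hξl0 hb₁).le
      (show 0 ≤ c * s t + m * (x₁ t + x₂ t) - (zu + e) by linarith)
    have e2 : 0 ≤ m * b₁ * (x₁ t - ξl * (x₁ t + x₂ t)) :=
      mul_nonneg (by positivity) (sub_nonneg.2 hl)
    have e3 : 0 ≤ m * x₁ t * (d t - b₁) := mul_nonneg (by positivity) (by linarith)
    have e4 : 0 ≤ c * s t * (d t - b₁) := mul_nonneg (by positivity) (by linarith)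
    have e5 : 0 ≤ c * s t * b₁ * (1 - ξl) := mul_nonneg (by positivity) (by linarith)
    have e6 : 0 ≤ c * s_in * (b₂ - d t) := mul_nonneg (by positivity) (by linarith)
    have e7 : 0 ≤ ν * x₁ t * (m - c * b) := mul_nonneg (by positivity) (by linarith)
    have e8 : 0 ≤ m * ν * x₂ t := by positivity
    linarith
  obtain ⟨T2, hT2⟩ := eventually_atTop.1 (E3.and E4)
  have E5 : ∀ᶠ t in atTop, xt ≤ x₁ t + x₂ t := by
    have hlog : ∀ t, max T2 0 ≤ t → HasDerivAt (fun t => Real.log (x₁ t + x₂ t))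
        ((-ν * (x₁ t + x₂ t) - d t * x₁ t + c * (s t / (a + s t)) * (x₁ t + x₂ t))
          / (x₁ t + x₂ t)) t := by
      intro t ht
      have ht0 : 0 ≤ t := (le_max_right _ _).trans ht
      obtain ⟨q1, q2, q3⟩ := hpos t ht0
      exact (hX t ht0).log (by positivity)
    have hA' : 0 < a + (zu + e) / c := by positivity
    have := eventually_ge_of_deriv _ _ (max T2 0) (Real.log xt)
      ((c / 2 * xt) / (a + (zu + e) / c)) (by positivity) hlog ?_
    · filter_upwards [this, eventually_ge_atTop 0] with t ht ht0
      obtain ⟨q1, q2, q3⟩ := hpos t ht0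
      exact (Real.log_le_log_iff hxt0 (by positivity)).1 ht
    intro t ht hle
    have ht0 : 0 ≤ t := (le_max_right _ _).trans ht
    obtain ⟨q1, q2, q3⟩ := hpos t ht0
    obtain ⟨z1, z2⟩ := hT2 t ((le_max_left _ _).trans ht)
    have hx : 0 < x₁ t + x₂ t := by positivity
    have hle' : x₁ t + x₂ t ≤ xt := (Real.log_le_log_iff hx hxt0).1 hle
    rw [le_div_iff₀ hx]
    have f1 : (c / 2 * xt + (ν + b₂) * (a + (zu + e) / c)) ≤ c * s t := by
      have : (zu + e) / c = zu / c + e / c := by ring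
      rw [this]
      have := mul_nonneg hm.le (sub_nonneg.2 hle')
      linarith
    have f2 : a + s t ≤ a + (zu + e) / c := by
      have : s t ≤ (zu + e) / c := by
        rw [le_div_iff₀ hc]
        have := mul_pos hm hx
        linarith
      linarith
    have f3 : c / 2 * xt / (a + (zu + e) / c) + (ν + b₂) ≤ c * (s t / (a + s t)) := by
      calc c / 2 * xt / (a + (zu + e) / c) + (ν + b₂)
          = (c / 2 * xt + (ν + b₂) * (a + (zu + e) / c)) / (a + (zu + e) / c) := by
            field_simp
        _ ≤ c * s t / (a + (zu + e) / c) := by gcongr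
        _ ≤ c * s t / (a + s t) := by gcongr
        _ = c * (s t / (a + s t)) := by ring
    have f4 := mul_le_mul_of_nonneg_right f3 hx.le
    have f5 : 0 ≤ (b₂ - d t) * x₁ t :=
      mul_nonneg (sub_nonneg.2 (hd_bounds t).2) q2.le
    have f6 := mul_pos hb₂ q3
    linarith
  have hub : ∀ᶠ t in atTop, x₁ t ≤ (zu + e) / m ∧ x₂ t ≤ (zu + e) / m := by
    filter_upwards [E4, eventually_ge_atTop 0] with t h4 ht0
    obtain ⟨q1, q2, q3⟩ := hpos t ht0
    have g1 := mul_pos hc q1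
    have g2 := mul_pos hm q2
    have g3 := mul_pos hm q3
    constructor <;> rw [le_div_iff₀ hm] <;> linarith
  refine ⟨⟨by positivity, ?_⟩, ⟨by positivity, ?_⟩, hξu'⟩
  · refine le_liminf_of_le ?_ ?_
    · exact (isBoundedUnder_of_eventually_le (hub.mono fun t h => h.1)).isCoboundedUnder_ge
    · filter_upwards [E1, E5, eventually_ge_atTop 0] with t h1 h5 ht0
      obtain ⟨q1, q2, q3⟩ := hpos t ht0
      rw [le_div_iff₀ (by positivity)] at h1
      exact (mul_le_mul_of_nonneg_left h5 hξl0.le).trans h1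
  · refine le_liminf_of_le ?_ ?_
    · exact (isBoundedUnder_of_eventually_le (hub.mono fun t h => h.2)).isCoboundedUnder_ge
    · filter_upwards [E2, E5, eventually_ge_atTop 0] with t h1 h5 ht0
      obtain ⟨q1, q2, q3⟩ := hpos t ht0
      rw [div_le_iff₀ (by positivity)] at h1
      have := mul_le_mul_of_nonneg_left h5 hξu1.le
      linarith
end

section
/- Let ω : ℝ → ℝ be continuous with ω(s)/s → 0 as s → −∞, and let β > 0, γ > 0. Define z(t) = γ ω(t) − β γ ∫_{−∞}^0 e^{β s} ω(t+s) ds (the integral converges absolutely by the sublinear growth of ω). Then z is continuous and satisfies, for all t ∈ ℝ, the pathwise integral form of the Langevin equation dz + β z dt = γ dω: z(t) = z(0) − β ∫₀ᵗ z(r) dr + γ (ω(t) − ω(0)). -/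
open Real MeasureTheory intervalIntegral Filter

/-- for any continuous path `ω` with sublinear growth at `−∞`,
the process `z(t) = γ ω(t) − β γ ∫_{−∞}^0 e^{β s} ω(t+s) ds` is a continuous
pathwise solution of the integral form of the Langevin equation
`dz + β z dt = γ dω`. -/
theorem ou_process_solves_langevin
    (ω : ℝ → ℝ) (hω_cont : Continuous ω)
    (hω_sub : Tendsto (fun s => ω s / s) atBot (nhds 0))
    (β γ : ℝ) (hβ : 0 < β) (hγ : 0 < γ)
    (z : ℝ → ℝ)
    (hz : ∀ t, z t = γ * ω t - β * γ * ∫ s in Set.Iic (0:ℝ), exp (β * s) * ω (t + s)) :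
    Continuous z ∧
    ∀ t : ℝ, z t = z 0 - β * (∫ r in (0:ℝ)..t, z r) + γ * (ω t - ω 0) := by
  have hgc : Continuous (fun u => exp (β * u) * ω u) := by fun_prop
  have hO : (fun u => exp (β * u) * ω u) =O[atBot] (fun u => exp ((β / 2) * u)) := by
    refine Asymptotics.IsBigO.of_bound (2 / β) ?_
    have h1 : ∀ᶠ s in atBot, |ω s / s| < 1 := by
      have := hω_sub.abs
      rw [abs_zero] at this
      exact this.eventually (gt_mem_nhds one_pos)
    filter_upwards [h1, eventually_lt_atBot (0 : ℝ)] with u hu hu0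
    have hw : |ω u| ≤ -u := by
      rw [abs_div, abs_of_neg hu0, div_lt_one (by linarith)] at hu
      exact hu.le
    have he : -u ≤ (2 / β) * exp (-(β / 2 * u)) := by
      have := add_one_le_exp (-(β / 2 * u))
      have h2 : -u = (2 / β) * (-(β / 2 * u)) := by field_simp
      rw [h2]
      exact mul_le_mul_of_nonneg_left (by linarith) (by positivity)
    rw [norm_mul, Real.norm_eq_abs, Real.norm_eq_abs, Real.norm_eq_abs, abs_exp, abs_exp]
    calc exp (β * u) * |ω u| ≤ exp (β * u) * ((2 / β) * exp (-(β / 2 * u))) := by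
          gcongr
          exact hw.trans he
      _ = (2 / β) * (exp (β * u) * exp (-(β / 2 * u))) := by ring
      _ = (2 / β) * exp (β / 2 * u) := by rw [← exp_add]; ring_nf
  have hint : ∀ a, IntegrableOn (fun u => exp (β * u) * ω u) (Set.Iic a) := fun a =>
    (hgc.locallyIntegrable.locallyIntegrableOn _).integrableOn_of_isBigO_atBot hO
      ⟨Set.Iic a, Iic_mem_atBot a, integrableOn_exp_mul_Iic (by positivity) a⟩
  obtain ⟨J, hJ⟩ : ∃ J : ℝ → ℝ, ∀ t, J t = ∫ s in Set.Iic (0:ℝ), exp (β * s) * ω (t + s) :=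
    ⟨_, fun _ => rfl⟩
  have hJ2 : ∀ t, J t = exp (-(β * t)) * ((∫ u in Set.Iic (0:ℝ), exp (β * u) * ω u)
      + ∫ u in (0:ℝ)..t, exp (β * u) * ω u) := by
    intro t
    rw [← integral_Iic_sub_Iic (hint 0) (hint t), add_sub_cancel, hJ]
    have hp := (measurePreserving_add_left volume t).setIntegral_preimage_emb
      (measurableEmbedding_addLeft t) (fun u => exp (β * u) * ω u) (Set.Iic t)
    rw [← hp, ← MeasureTheory.integral_const_mul]
    have : (fun x => t + x) ⁻¹' Set.Iic t = Set.Iic 0 := by ext x; simp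
    rw [this]
    congr 1
    ext s
    rw [← mul_assoc, ← exp_add]
    ring_nf
  have hd : ∀ t, HasDerivAt J (ω t - β * J t) t := by
    intro t
    have h1 : HasDerivAt (fun t => exp (-(β * t))) (exp (-(β * t)) * (-(β * 1))) t :=
      (((hasDerivAt_id t).const_mul β).neg).exp
    have h2 := (hgc.integral_hasStrictDerivAt 0 t).hasDerivAt.const_add
      (∫ u in Set.Iic (0:ℝ), exp (β * u) * ω u)
    have h3 := h1.mul h2
    rw [funext hJ2]
    refine h3.congr_deriv ?_
    have : exp (-(β * t)) * exp (β * t) = 1 := by rw [← exp_add]; simp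
    linear_combination ω t * this
  have hJc : Continuous J := continuous_iff_continuousAt.2 fun t => (hd t).continuousAt
  have hz' : ∀ t, z t = γ * (ω t - β * J t) := fun t => by rw [hz, hJ]; ring
  refine ⟨by rw [funext hz']; fun_prop, fun t => ?_⟩
  have hI : ∫ r in (0:ℝ)..t, z r = γ * (J t - J 0) := by
    simp_rw [hz']
    rw [intervalIntegral.integral_const_mul, integral_eq_sub_of_hasDerivAt (fun x _ => hd x)]
    exact Continuous.intervalIntegrable (by fun_prop) _ _
  rw [hI, hz', hz']
  ring
end

section
/- Let ω : ℝ → ℝ be continuous with ω(s)/s → 0 as s → −∞, and let γ > 0. For β > 0 define z_β(t) = γ ω(t) − β γ ∫_{−∞}^0 e^{β s} ω(t+s) ds. Then for every t ∈ ℝ, lim_{β→∞} β ∫_{−∞}^0 e^{β s} ω(t+s) ds = ω(t), and consequently lim_{β→∞} z_β(t) = 0. -/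
open Real MeasureTheory Filter

theorem ou_bound (ω : ℝ → ℝ) (hc : Continuous ω)
    (hs : Tendsto (fun s => ω s / s) atBot (nhds 0)) (t : ℝ) :
    ∃ C : ℝ, ∀ v : ℝ, 0 ≤ v → |ω (t - v)| ≤ C * exp (v / 2) := by
  have h1 : ∀ᶠ s in atBot, |ω s| ≤ |s| := by
    have h := hs.abs.eventually_le_const (show |(0:ℝ)| < 1 by simp)
    filter_upwards [h, eventually_lt_atBot (0:ℝ)] with s h h0
    rw [abs_div, div_le_one (abs_pos.mpr h0.ne)] at h
    exact h
  obtain ⟨S, hS⟩ := eventually_atBot.mp h1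
  obtain ⟨M, hM⟩ := (isCompact_Icc (a := S) (b := t)).exists_bound_of_continuousOn hc.continuousOn
  refine ⟨|M| + |t| + 2, fun v hv => ?_⟩
  have e1 : v / 2 + 1 ≤ exp (v / 2) := add_one_le_exp _
  have hb : |ω (t - v)| ≤ |M| + |t| + v := by
    rcases le_total (t - v) S with h | h
    · have := hS _ h
      have h2 := abs_sub t v
      rw [abs_of_nonneg hv] at h2
      linarith [abs_nonneg M]
    · have := hM (t - v) ⟨h, by linarith⟩
      rw [Real.norm_eq_abs] at this
      linarith [abs_nonneg t, le_abs_self M]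
  nlinarith [abs_nonneg M, abs_nonneg t]

theorem ou_subst (ω : ℝ → ℝ) (t β : ℝ) (hβ : 0 < β) :
    β * ∫ s in Set.Iic (0:ℝ), exp (β * s) * ω (t + s)
      = ∫ u in Set.Ioi (0:ℝ), exp (-u) * ω (t - β⁻¹ * u) := by
  have h1 := integral_comp_neg_Ioi (0:ℝ) (fun s => exp (β * s) * ω (t + s))
  have h2 := integral_comp_mul_left_Ioi (fun u => exp (-u) * ω (t - β⁻¹ * u)) 0 hβ
  rw [neg_zero] at h1
  rw [mul_zero, smul_eq_mul] at h2
  rw [← h1]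
  have h3 : (∫ x in Set.Ioi (0:ℝ), exp (β * -x) * ω (t + -x))
      = ∫ x in Set.Ioi (0:ℝ), exp (-(β * x)) * ω (t - β⁻¹ * (β * x)) := by
    congr 1
    ext x
    rw [inv_mul_cancel_left₀ hβ.ne', mul_neg, sub_eq_add_neg]
  rw [h3, h2, mul_inv_cancel_left₀ hβ.ne']

theorem ou_lim (ω : ℝ → ℝ) (hc : Continuous ω)
    (hs : Tendsto (fun s => ω s / s) atBot (nhds 0)) (t : ℝ) :
    Tendsto (fun β : ℝ => β * ∫ s in Set.Iic (0:ℝ), exp (β * s) * ω (t + s))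
        atTop (nhds (ω t)) := by
  obtain ⟨C, hC⟩ := ou_bound ω hc hs t
  have hC0 : 0 ≤ C := by
    have := (abs_nonneg _).trans (hC 0 le_rfl)
    simpa using this
  have key : Tendsto (fun β : ℝ => ∫ u in Set.Ioi (0:ℝ), exp (-u) * ω (t - β⁻¹ * u)) atTop
      (nhds (∫ u in Set.Ioi (0:ℝ), exp (-u) * ω t)) := by
    apply tendsto_integral_filter_of_dominated_convergence (fun u => C * exp ((-(1/2)) * u))
    · refine Eventually.of_forall fun β => ?_
      exact Continuous.aestronglyMeasurable (by fun_prop)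
    · filter_upwards [eventually_ge_atTop (1:ℝ)] with β hβ
      filter_upwards [ae_restrict_mem measurableSet_Ioi] with u hu
      have hu : 0 < u := hu
      have hβ' : β⁻¹ ≤ 1 := inv_le_one_of_one_le₀ hβ
      have hv : 0 ≤ β⁻¹ * u := by positivity
      have hv' : β⁻¹ * u ≤ u := by nlinarith
      rw [Real.norm_eq_abs, abs_mul, abs_of_pos (exp_pos _)]
      calc exp (-u) * |ω (t - β⁻¹ * u)| ≤ exp (-u) * (C * exp (u / 2)) := by
            gcongr
            refine (hC _ hv).trans ?_
            gcongr
        _ = C * exp ((-(1/2)) * u) := by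
            rw [mul_left_comm, ← exp_add]
            ring_nf
    · exact (integrableOn_exp_mul_Ioi (by norm_num) 0).const_mul C
    · refine Eventually.of_forall fun u => ?_
      have h : Tendsto (fun β : ℝ => t - β⁻¹ * u) atTop (nhds t) := by
        simpa using (tendsto_inv_atTop_zero.mul_const u).const_sub t
      exact ((hc.tendsto t).comp h).const_mul _
  rw [integral_mul_const, integral_exp_neg_Ioi_zero, one_mul] at key
  refine key.congr' ?_
  filter_upwards [eventually_gt_atTop (0:ℝ)] with β hβ
  exact (ou_subst ω t β hβ).symm

/-- for any continuous path `ω` with sublinear growth at `−∞`,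
`β ∫_{−∞}^0 e^{β s} ω(t+s) ds → ω(t)` as `β → ∞`, hence the Ornstein–Uhlenbeck
realization `z_β(t) = γ ω(t) − β γ ∫_{−∞}^0 e^{β s} ω(t+s) ds` tends to `0`
as `β → ∞`, for every `t`. -/
theorem ou_process_tendsto_zero_of_large_mean_reversion
    (ω : ℝ → ℝ) (hω_cont : Continuous ω)
    (hω_sub : Tendsto (fun s => ω s / s) atBot (nhds 0))
    (γ : ℝ) (hγ : 0 < γ) :
    ∀ t : ℝ,
      Tendsto (fun β : ℝ => β * ∫ s in Set.Iic (0:ℝ), exp (β * s) * ω (t + s))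
        atTop (nhds (ω t)) ∧
      Tendsto (fun β : ℝ =>
          γ * ω t - β * γ * ∫ s in Set.Iic (0:ℝ), exp (β * s) * ω (t + s))
        atTop (nhds 0) := by
  intro t
  have h := ou_lim ω hω_cont hω_sub t
  refine ⟨h, ?_⟩
  have h2 := (h.const_mul γ).const_sub (γ * ω t)
  rw [sub_self] at h2
  refine h2.congr fun β => ?_
  ring
end
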